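/- Let I be a Cohen-Macaulay R-ideal of positive grade, let C be an R-ideal, and let e ≥ 1 be an integer. Then the following are equivalent: (a) for some (equivalently, every) e-th generic link L_e(I) ⊆ R[X] one has L_e(I) ⊆ C·R[X]; (b) for some (equivalently, every) e-th universal link L^e(I) ⊆ R(X) one has L^e(I) ⊆ C·R(X). -/

import Mathlib

open RingTheory IsLocalRing

/-- A proper ideal generated by a regular sequence is a complete intersection. -/
def IsCompleteIntersectionIdeal (R : Type) [CommRing R] (I : Ideal R) : Prop :=
  I ≠ ⊤ ∧ ∃ rs : List R, RingTheory.Sequence.IsRegular R rs ∧ Ideal.ofList rs = I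

/-- Two proper ideals are directly linked if there is a complete intersection
`c ⊆ I ⊓ J` with `I = c : J` and `J = c : I`. -/
def IsDirectlyLinked (R : Type) [CommRing R] (I J : Ideal R) : Prop :=
  I ≠ ⊤ ∧ J ≠ ⊤ ∧ ∃ c : Ideal R, IsCompleteIntersectionIdeal R c ∧ c ≤ I ⊓ J ∧
    Submodule.colon c J = I ∧ Submodule.colon c I = J

/-- The linkage (liaison) equivalence: the equivalence relation generated by direct linkage. -/
def InSameLinkageClass (R : Type) [CommRing R] (I J : Ideal R) : Prop :=
  Relation.EqvGen (IsDirectlyLinked R) I J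

/-- An ideal is licci if its linkage class contains a complete intersection. -/
def Licci (R : Type) [CommRing R] (I : Ideal R) : Prop :=
  ∃ J, InSameLinkageClass R I J ∧ IsCompleteIntersectionIdeal R J

open Classical in
/-- `∫ I` : the sum of all ideals in the linkage class of `I` if `I` is not licci,
and the unit ideal otherwise. -/
noncomputable def intLink (R : Type) [CommRing R] (I : Ideal R) : Ideal R :=
  if Licci R I then ⊤ else sSup {J : Ideal R | InSameLinkageClass R I J}

/-- An ideal is maximal in its linkage class if it contains every ideal in its linkage class. -/
def MaximalInLinkageClass (R : Type) [CommRing R] (I : Ideal R) : Prop :=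
  ∀ J, InSameLinkageClass R I J → J ≤ I

/-- Linked in `n` steps. -/
def LinkedInSteps (R : Type) [CommRing R] : ℕ → Ideal R → Ideal R → Prop
  | 0, I, J => I = J
  | (n+1), I, J => ∃ K, IsDirectlyLinked R I K ∧ LinkedInSteps R n K J

/-- The grade of an ideal: the supremum of lengths of regular sequences contained in it. -/
noncomputable def gradeOf (R : Type) [CommRing R] (I : Ideal R) : ℕ :=
  sSup {n : ℕ | ∃ rs : List R, rs.length = n ∧ (∀ r ∈ rs, r ∈ I) ∧
    RingTheory.Sequence.IsRegular R rs}

/-- A Noetherian local ring is Cohen-Macaulay if its depth (the grade of its maximal ideal)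
equals its Krull dimension. -/
def IsCMLocalRing (A : Type) [CommRing A] [IsLocalRing A] : Prop :=
  ringKrullDim A = (gradeOf A (maximalIdeal A) : WithBot (WithTop ℕ))

/-- An ideal `I` of `R` is a Cohen-Macaulay ideal if `R/I` is a Cohen-Macaulay local ring. -/
def IsCMIdeal (R : Type) [CommRing R] (I : Ideal R) : Prop :=
  ∃ h : IsLocalRing (R ⧸ I), @IsCMLocalRing (R ⧸ I) _ h

/-- A Noetherian local ring is Gorenstein if it is Cohen-Macaulay and some ideal generated
by a regular sequence and primary to the maximal ideal is irreducible. -/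
def IsGorensteinLocalRing (A : Type) [CommRing A] [IsLocalRing A] : Prop :=
  IsCMLocalRing A ∧ ∃ rs : List A, RingTheory.Sequence.IsRegular A rs ∧
    (Ideal.ofList rs).radical = maximalIdeal A ∧ InfIrred (Ideal.ofList rs)

open MvPolynomial in
/-- The first generic link `(α₁,…,α_g) : L·B[X]` built from a generating set `f` of `L`,
where `αᵢ = Σⱼ Xⱼᵢ·fⱼ`. -/
noncomputable def genericLinkIdeal {B : Type} [CommRing B] {n : ℕ} (g : ℕ)
    (f : Fin n → B) (L : Ideal B) : Ideal (MvPolynomial (Fin n × Fin g) B) :=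
  Submodule.colon
    (Ideal.span (Set.range fun i : Fin g =>
      ∑ j : Fin n, (X (j, i) : MvPolynomial (Fin n × Fin g) B) * C (f j)))
    (L.map (C : B →+* MvPolynomial (Fin n × Fin g) B))

/-- `IsGenericLinkOf R e I B φ L` says that `L ⊆ B` is an `e`-th generic link of `I`,
obtained by iterating the first generic link construction (with respect to some choice
of finite generating set at each stage); `φ : R →+* B` is the natural inclusion into the
iterated polynomial extension. -/
inductive IsGenericLinkOf (R : Type) [CommRing R] :
    ℕ → Ideal R → (B : CommRingCat.{0}) → (R →+* B) → Ideal B → Prop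
  | zero (I : Ideal R) : IsGenericLinkOf R 0 I (CommRingCat.of R) (RingHom.id R) I
  | succ {e : ℕ} {I : Ideal R} {B : CommRingCat.{0}} {φ : R →+* B} {L : Ideal B}
      (h : IsGenericLinkOf R e I B φ L) (n : ℕ) (f : Fin n → B)
      (hf : Ideal.span (Set.range f) = L) :
      IsGenericLinkOf R (e+1) I
        (CommRingCat.of (MvPolynomial (Fin n × Fin (gradeOf B L)) B))
        ((MvPolynomial.C : B →+* MvPolynomial (Fin n × Fin (gradeOf B L)) B).comp φ)
        (genericLinkIdeal (gradeOf B L) f L)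

/-- `IsUniversalLinkOf R e I B φ L` says that `L ⊆ B` is an `e`-th universal link of `I`:
at each stage one passes from the current local ring `B'` to
`B'(X) = B'[X]` localized at the extension of the maximal ideal of `B'`, and extends the
first generic link there. -/
inductive IsUniversalLinkOf (R : Type) [CommRing R] :
    ℕ → Ideal R → (B : CommRingCat.{0}) → (R →+* B) → Ideal B → Prop
  | zero (I : Ideal R) : IsUniversalLinkOf R 0 I (CommRingCat.of R) (RingHom.id R) I
  | succ {e : ℕ} {I : Ideal R} {B : CommRingCat.{0}} {φ : R →+* B} {L : Ideal B}
      (h : IsUniversalLinkOf R e I B φ L) (hB : IsLocalRing B) (n : ℕ) (f : Fin n → B)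
      (hf : Ideal.span (Set.range f) = L)
      (hQ : (((@IsLocalRing.maximalIdeal B _ hB).map
          (MvPolynomial.C : B →+* MvPolynomial (Fin n × Fin (gradeOf B L)) B))).IsPrime) :
      IsUniversalLinkOf R (e+1) I
        (CommRingCat.of (Localization (@Ideal.primeCompl _ _ _ hQ)))
        ((algebraMap (MvPolynomial (Fin n × Fin (gradeOf B L)) B)
            (Localization (@Ideal.primeCompl _ _ _ hQ))).comp
          ((MvPolynomial.C : B →+* MvPolynomial (Fin n × Fin (gradeOf B L)) B).comp φ))
        ((genericLinkIdeal (gradeOf B L) f L).map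
          (algebraMap (MvPolynomial (Fin n × Fin (gradeOf B L)) B)
            (Localization (@Ideal.primeCompl _ _ _ hQ))))

/-- **McCoy's theorem** for multivariate polynomials: a polynomial not annihilated by any nonzero
constant is not a zero divisor. -/
theorem MvPolynomial.eq_zero_of_mul_eq_zero_of_forall_C_mul {A σ : Type*} [CommRing A] [Finite σ]
    {F : MvPolynomial σ A} (hF : ∀ a : A, (∀ d, a * F.coeff d = 0) → a = 0)
    {p : MvPolynomial σ A} (hp : F * p = 0) : p = 0 := by
  classical
  obtain ⟨_, _⟩ := exists_wellFoundedLT σ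
  let m : MonomialOrder σ := MonomialOrder.lex
  by_contra hne
  obtain ⟨q, ⟨hq0, hFq⟩, hmin⟩ := (InvImage.wf (fun q : MvPolynomial σ A ↦ m.toSyn (m.degree q))
    m.wellFoundedLT_syn.wf).has_min {q | q ≠ 0 ∧ F * q = 0} ⟨p, hne, hp⟩
  by_cases hall : ∀ d, MvPolynomial.C (F.coeff d) * q = 0
  · refine hq0 (MvPolynomial.ext _ _ fun c ↦ ?_)
    refine hF _ fun d ↦ ?_
    have := congrArg (MvPolynomial.coeff c) (hall d)
    rw [MvPolynomial.coeff_C_mul] at this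
    simpa [mul_comm] using this
  · push Not at hall
    let s : Finset (σ →₀ ℕ) := F.support.filter fun d ↦ MvPolynomial.C (F.coeff d) * q ≠ 0
    have hs : s.Nonempty := by
      obtain ⟨d, hd⟩ := hall
      refine ⟨d, Finset.mem_filter.2 ⟨MvPolynomial.mem_support_iff.2 fun h ↦ hd ?_, hd⟩⟩
      simp [h]
    obtain ⟨d, hd, hmax⟩ := s.exists_max_image m.toSyn hs
    have hd2 := (Finset.mem_filter.1 hd).2
    have hlead : F.coeff d * m.leadingCoeff q = 0 := by
      have hc := congrArg (MvPolynomial.coeff (d + m.degree q)) hFq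
      rw [MvPolynomial.coeff_mul, MvPolynomial.coeff_zero,
        Finset.sum_eq_single (d, m.degree q)] at hc
      · exact hc
      · rintro ⟨b, c⟩ hbc hne'
        rw [Finset.HasAntidiagonal.mem_antidiagonal] at hbc
        by_contra hprod
        dsimp only at hbc hprod
        have hb : b ∈ s := by
          refine Finset.mem_filter.2 ⟨MvPolynomial.mem_support_iff.2 fun h ↦ hprod (by simp [h]),
            fun h ↦ hprod ?_⟩
          have := congrArg (MvPolynomial.coeff c) h
          rwa [MvPolynomial.coeff_C_mul] at this
        have hble := hmax b hb
        have hcle : m.toSyn c ≤ m.toSyn (m.degree q) :=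
          m.le_degree (MvPolynomial.mem_support_iff.2 fun h ↦ hprod (by simp [h]))
        have hsum : m.toSyn b + m.toSyn c = m.toSyn d + m.toSyn (m.degree q) := by
          rw [← map_add, ← map_add, hbc]
        have hbd : m.toSyn b = m.toSyn d := by
          refine le_antisymm hble ?_
          by_contra hlt
          exact absurd hsum (add_lt_add_of_lt_of_le (not_le.1 hlt) hcle).ne
        have hb' : b = d := m.toSyn.injective hbd
        have hc' : c = m.degree q := by
          subst hb'
          exact add_left_cancel hbc
        exact hne' (by rw [hb', hc'])
      · intro h
        exfalso
        apply h
        rw [Finset.HasAntidiagonal.mem_antidiagonal]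
    refine hmin (MvPolynomial.C (F.coeff d) * q) ⟨hd2, by rw [mul_left_comm, hFq, mul_zero]⟩ ?_
    change m.toSyn (m.degree _) < m.toSyn (m.degree q)
    refine lt_of_le_of_ne ?_ fun h ↦ ?_
    · refine m.degree_le_iff.2 fun c hc ↦ m.le_degree (MvPolynomial.mem_support_iff.2 fun h ↦ ?_)
      rw [MvPolynomial.mem_support_iff, MvPolynomial.coeff_C_mul, h, mul_zero] at hc
      exact hc rfl
    · have h' := m.toSyn.injective h
      have : m.leadingCoeff (MvPolynomial.C (F.coeff d) * q) = 0 := by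
        rw [MonomialOrder.leadingCoeff, h', MvPolynomial.coeff_C_mul]
        exact hlead
      exact hd2 (m.leadingCoeff_eq_zero_iff.1 this)

/-- McCoy's theorem modulo an ideal. -/
theorem MvPolynomial.mem_map_C_of_mul_mem {A σ : Type*} [CommRing A] [Finite σ] {J : Ideal A}
    {F : MvPolynomial σ A} (hF : ∀ a : A, (∀ d, a * F.coeff d ∈ J) → a ∈ J)
    {p : MvPolynomial σ A} (hp : F * p ∈ J.map MvPolynomial.C) :
    p ∈ J.map (MvPolynomial.C (σ := σ)) := by
  have key : ∀ q : MvPolynomial σ A, q ∈ J.map (MvPolynomial.C (σ := σ)) ↔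
      MvPolynomial.map (Ideal.Quotient.mk J) q = 0 := by
    intro q
    rw [← RingHom.mem_ker, MvPolynomial.ker_map, Ideal.mk_ker]
  rw [key] at hp ⊢
  rw [map_mul] at hp
  refine MvPolynomial.eq_zero_of_mul_eq_zero_of_forall_C_mul (fun a ha ↦ ?_) hp
  obtain ⟨a, rfl⟩ := Ideal.Quotient.mk_surjective a
  refine Ideal.Quotient.eq_zero_iff_mem.2 (hF a fun d ↦ ?_)
  rw [← Ideal.Quotient.eq_zero_iff_mem, map_mul]
  simpa [MvPolynomial.coeff_map] using ha d

/-- Over a local ring, a polynomial with a unit coefficient is regular modulo every extended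
ideal. -/
theorem MvPolynomial.mem_map_C_of_mul_mem_of_notMem {A σ : Type*} [CommRing A] [IsLocalRing A]
    [Finite σ] {J : Ideal A} {F : MvPolynomial σ A}
    (hF : F ∉ (maximalIdeal A).map (MvPolynomial.C (σ := σ)))
    {p : MvPolynomial σ A} (hp : F * p ∈ J.map MvPolynomial.C) :
    p ∈ J.map (MvPolynomial.C (σ := σ)) := by
  refine MvPolynomial.mem_map_C_of_mul_mem (fun a ha ↦ ?_) hp
  rw [MvPolynomial.mem_map_C_iff] at hF
  push Not at hF
  obtain ⟨d, hd⟩ := hF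
  have hu : IsUnit (F.coeff d) := by simpa using hd
  exact (Ideal.mul_unit_mem_iff_mem J hu).1 (ha d)

theorem MvPolynomial.isPrime_map_C {A σ : Type*} [CommRing A] {J : Ideal A}
    (hJ : J.IsPrime) : (J.map (MvPolynomial.C (σ := σ))).IsPrime := by
  have := RingHom.ker_isPrime (MvPolynomial.map (σ := σ) (Ideal.Quotient.mk J))
  rwa [MvPolynomial.ker_map, Ideal.mk_ker] at this

/-- Multiplication by `x` is injective modulo `K`. -/
def RegularMod {A : Type*} [CommRing A] (K : Ideal A) (x : A) : Prop :=
  ∀ r, x * r ∈ K → r ∈ K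

/-- The ideal `J + (x₀, …, xₙ₋₁)`. -/
def partialIdeal {A : Type*} [CommRing A] (J : Ideal A) (x : ℕ → A) : ℕ → Ideal A
  | 0 => J
  | n + 1 => partialIdeal J x n ⊔ Ideal.span {x n}

/-- The sequence `x₀, …, xₙ₋₁` is weakly regular modulo `J`. -/
def RegularUpTo {A : Type*} [CommRing A] (J : Ideal A) (x : ℕ → A) (n : ℕ) : Prop :=
  ∀ i < n, RegularMod (partialIdeal J x i) (x i)

/-- No nonzero element of `A ⧸ K` is annihilated by `I`. -/
def ColonTrivial {A : Type*} [CommRing A] (I K : Ideal A) : Prop :=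
  ∀ u, (∀ t ∈ I, u * t ∈ K) → u ∈ K

section RegularSequences

variable {A : Type*} [CommRing A]

theorem RegularMod.colonTrivial {I K : Ideal A} {x : A} (hx : x ∈ I) (h : RegularMod K x) :
    ColonTrivial I K :=
  fun u hu ↦ h u (mul_comm u x ▸ hu x hx)

theorem le_partialIdeal (J : Ideal A) (x : ℕ → A) (n : ℕ) : J ≤ partialIdeal J x n := by
  induction n with
  | zero => exact le_rfl
  | succ n ih => exact ih.trans le_sup_left

theorem mem_partialIdeal (J : Ideal A) (x : ℕ → A) {i n : ℕ} (h : i < n) :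
    x i ∈ partialIdeal J x n := by
  induction n with
  | zero => omega
  | succ n ih =>
    rcases Nat.lt_succ_iff_lt_or_eq.1 h with h | rfl
    · exact Ideal.mem_sup_left (ih h)
    · exact Ideal.mem_sup_right (Ideal.mem_span_singleton_self _)

theorem partialIdeal_le {J K : Ideal A} {x : ℕ → A} {n : ℕ} (hJ : J ≤ K)
    (hx : ∀ i < n, x i ∈ K) : partialIdeal J x n ≤ K := by
  induction n with
  | zero => exact hJ
  | succ n ih =>
    refine sup_le (ih fun i hi ↦ hx i (by omega)) ?_
    rw [Ideal.span_singleton_le_iff_mem]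
    exact hx n (by omega)

theorem partialIdeal_sup_span (J : Ideal A) (x : ℕ → A) (z : A) (n : ℕ) :
    partialIdeal (J ⊔ Ideal.span {z}) x n = partialIdeal J x n ⊔ Ideal.span {z} := by
  induction n with
  | zero => rfl
  | succ n ih => rw [partialIdeal, partialIdeal, ih, sup_right_comm]

theorem mem_sup_span_singleton_iff {K : Ideal A} {z a : A} :
    a ∈ K ⊔ Ideal.span {z} ↔ ∃ w, a - z * w ∈ K := by
  rw [Submodule.mem_sup]
  constructor
  · rintro ⟨k, hk, y, hy, rfl⟩
    obtain ⟨w, rfl⟩ := Ideal.mem_span_singleton'.1 hy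
    exact ⟨w, by simpa [mul_comm] using hk⟩
  · rintro ⟨w, hw⟩
    exact ⟨_, hw, z * w, Ideal.mul_mem_right _ _ (Ideal.mem_span_singleton_self z), by ring⟩

theorem ColonTrivial.sup_span_of_regularMod {I K : Ideal A} {a z : A} (ha : a ∈ I)
    (hra : RegularMod K a) (hrz : RegularMod K z)
    (h : ColonTrivial I (K ⊔ Ideal.span {a})) : ColonTrivial I (K ⊔ Ideal.span {z}) := by
  intro u hu
  obtain ⟨v, hv⟩ := mem_sup_span_singleton_iff.1 (hu a ha)
  have hvmem : v ∈ K ⊔ Ideal.span {a} := by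
    refine h v fun t ht ↦ ?_
    obtain ⟨w, hw⟩ := mem_sup_span_singleton_iff.1 (hu t ht)
    refine mem_sup_span_singleton_iff.2 ⟨w, hrz _ ?_⟩
    have := K.sub_mem (K.mul_mem_left a hw) (K.mul_mem_left t hv)
    convert this using 1
    ring
  obtain ⟨v', hv'⟩ := mem_sup_span_singleton_iff.1 hvmem
  refine mem_sup_span_singleton_iff.2 ⟨v', hra _ ?_⟩
  have := K.add_mem hv (K.mul_mem_left z hv')
  convert this using 1
  ring

theorem RegularUpTo.sup_span {J : Ideal A} {x : ℕ → A} {n : ℕ} {z : A}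
    (hx : RegularUpTo J x n) (hz : ∀ i ≤ n, RegularMod (partialIdeal J x i) z) :
    RegularUpTo (J ⊔ Ideal.span {z}) x n := by
  intro i hi r hr
  rw [partialIdeal_sup_span] at hr ⊢
  obtain ⟨t, ht⟩ := mem_sup_span_singleton_iff.1 hr
  have ht' : t ∈ partialIdeal J x (i + 1) := by
    refine hz (i + 1) (by omega) _ ?_
    refine mem_sup_span_singleton_iff.2 ⟨r, ?_⟩
    rw [← neg_mem_iff]
    convert ht using 1
    ring
  obtain ⟨t', ht'⟩ := mem_sup_span_singleton_iff.1 ht'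
  refine mem_sup_span_singleton_iff.2 ⟨t', hx i hi _ ?_⟩
  have := Ideal.add_mem _ ht (Ideal.mul_mem_left _ z ht')
  convert this using 1
  ring

theorem exists_mem_regularMod [IsNoetherianRing A] {I : Ideal A} {ι : Type*} {s : Set ι}
    (hs : s.Finite) (K : ι → Ideal A) (h : ∀ i ∈ s, ColonTrivial I (K i)) :
    ∃ z ∈ I, ∀ i ∈ s, RegularMod (K i) z := by
  have hfin : (⋃ i ∈ s, associatedPrimes A (A ⧸ K i)).Finite :=
    hs.biUnion fun i _ ↦ associatedPrimes.finite A (A ⧸ K i)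
  have hprime : ∀ P ∈ ⋃ i ∈ s, associatedPrimes A (A ⧸ K i), P ≠ 0 → P ≠ 0 → (id P).IsPrime := by
    intro P hP _ _
    obtain ⟨i, _, hi⟩ := Set.mem_iUnion₂.1 hP
    exact hi.isPrime
  by_contra! hcon
  have hsub : (I : Set A) ⊆
      ⋃ P ∈ ⋃ i ∈ s, associatedPrimes A (A ⧸ K i), ((id P : Ideal A) : Set A) := by
    intro z hz
    obtain ⟨i, hi, hzi⟩ := hcon z hz
    have hnot : z ∈ ⋃ P ∈ associatedPrimes A (A ⧸ K i), (P : Set A) := by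
      rw [biUnion_associatedPrimes_eq_compl_regular]
      intro hreg
      refine hzi fun r hr ↦ ?_
      exact mem_of_isSMulRegular_quotient_of_smul_mem hreg hr
    obtain ⟨P, hP, hzP⟩ := Set.mem_iUnion₂.1 hnot
    exact Set.mem_iUnion₂.2 ⟨P, Set.mem_iUnion₂.2 ⟨i, hi, hP⟩, hzP⟩
  obtain ⟨P, hP, hIP⟩ := (Ideal.subset_union_prime_finite hfin 0 0 hprime).1 hsub
  obtain ⟨i, hi, hPi⟩ := Set.mem_iUnion₂.1 hP
  obtain ⟨hPp, u, hu⟩ := (isAssociatedPrime_iff (R := A)).1 hPi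
  obtain ⟨u, rfl⟩ := Ideal.Quotient.mk_surjective u
  have hmem : ∀ t, t ∈ P ↔ u * t ∈ K i := by
    intro t
    rw [hu, Submodule.mem_colon_singleton, Submodule.mem_bot, mul_comm,
      ← Ideal.Quotient.eq_zero_iff_mem, map_mul]
    rfl
  refine hPp.ne_top ((Ideal.eq_top_iff_one P).2 ((hmem 1).2 ?_))
  rw [mul_one]
  exact h i hi u fun t ht ↦ (hmem t).1 (hIP ht)

/-- **Rees' theorem**: whether `I` consists of zero divisors modulo a weakly regular sequence in
`I` of length `n` does not depend on the sequence. -/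
theorem ColonTrivial.of_regularUpTo [IsNoetherianRing A] {I : Ideal A} (n : ℕ) :
    ∀ {J : Ideal A} {x y : ℕ → A}, (∀ i < n, x i ∈ I) → (∀ i < n, y i ∈ I) →
      RegularUpTo J x n → RegularUpTo J y n → ColonTrivial I (partialIdeal J x n) →
      ColonTrivial I (partialIdeal J y n) := by
  induction n with
  | zero => exact fun _ _ _ _ h ↦ h
  | succ n ih =>
    intro J x y hxI hyI hx hy hc
    obtain ⟨z, hzI, hz⟩ := exists_mem_regularMod (I := I)
      (s := (Set.Iic n ×ˢ (Set.univ : Set Bool))) ((Set.finite_Iic n).prod Set.finite_univ)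
      (fun p ↦ partialIdeal J (bif p.2 then x else y) p.1) (by
        rintro ⟨i, b⟩ ⟨hi, -⟩
        have hi' : i < n + 1 := Nat.lt_succ_of_le hi
        cases b
        · exact (hy i hi').colonTrivial (hyI i hi')
        · exact (hx i hi').colonTrivial (hxI i hi'))
    have hzx : ∀ i ≤ n, RegularMod (partialIdeal J x i) z := fun i hi ↦ hz (i, true) ⟨hi, trivial⟩
    have hzy : ∀ i ≤ n, RegularMod (partialIdeal J y i) z := fun i hi ↦ hz (i, false) ⟨hi, trivial⟩
    have hx' : RegularUpTo J x n := fun i hi ↦ hx i (by omega)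
    have hy' : RegularUpTo J y n := fun i hi ↦ hy i (by omega)
    have h1 := ColonTrivial.sup_span_of_regularMod (hxI n (by omega)) (hx n (by omega))
      (hzx n le_rfl) hc
    rw [← partialIdeal_sup_span] at h1
    have h2 := ih (fun i hi ↦ hxI i (by omega)) (fun i hi ↦ hyI i (by omega))
      (hx'.sup_span hzx) (hy'.sup_span hzy) h1
    rw [partialIdeal_sup_span] at h2
    exact ColonTrivial.sup_span_of_regularMod hzI (hzy n le_rfl) (hy n (by omega)) h2

theorem ofList_take_eq_partialIdeal (rs : List A) {i : ℕ} (hi : i ≤ rs.length) :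
    Ideal.ofList (rs.take i) = partialIdeal ⊥ (fun j ↦ rs.getD j 0) i := by
  induction i with
  | zero => simp [partialIdeal]
  | succ i ih =>
    rw [List.take_succ_eq_append_getElem (by omega), Ideal.ofList_append, ih (by omega),
      partialIdeal, Ideal.ofList_singleton, List.getD_eq_getElem _ _ (by omega)]

theorem isWeaklyRegular_iff_regularUpTo (rs : List A) :
    RingTheory.Sequence.IsWeaklyRegular A rs ↔
      RegularUpTo ⊥ (fun j ↦ rs.getD j 0) rs.length := by
  rw [RingTheory.Sequence.isWeaklyRegular_iff]
  refine forall₂_congr fun i hi ↦ ?_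
  rw [isSMulRegular_quotient_iff_mem_of_smul_mem, smul_eq_mul, Ideal.mul_top,
    ofList_take_eq_partialIdeal _ hi.le, ← List.getD_eq_getElem _ 0 hi]
  rfl

theorem isRegular_iff_regularUpTo (rs : List A) :
    RingTheory.Sequence.IsRegular A rs ↔
      RegularUpTo ⊥ (fun j ↦ rs.getD j 0) rs.length ∧
        partialIdeal ⊥ (fun j ↦ rs.getD j 0) rs.length ≠ ⊤ := by
  rw [RingTheory.Sequence.isRegular_iff, isWeaklyRegular_iff_regularUpTo, smul_eq_mul,
    Ideal.mul_top, ← ofList_take_eq_partialIdeal _ le_rfl, List.take_length, ne_comm]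

theorem ringKrullDim_quotient_partialIdeal_add_le {x : ℕ → A} {n : ℕ} (hx : RegularUpTo ⊥ x n) :
    ringKrullDim (A ⧸ partialIdeal ⊥ x n) + n ≤ ringKrullDim A := by
  induction n with
  | zero => simpa using ringKrullDim_quotient_le _
  | succ n ih =>
    refine le_trans ?_ (ih fun i hi ↦ hx i (by omega))
    push_cast
    rw [add_comm (n : WithBot ℕ∞) 1, ← add_assoc]
    gcongr
    have hle : partialIdeal ⊥ x n ≤ partialIdeal ⊥ x (n + 1) := le_sup_left
    refine ringKrullDim_succ_le_of_surjective (Ideal.Quotient.factor hle)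
      (Ideal.Quotient.factor_surjective _)
      (r := Ideal.Quotient.mk _ (x n)) ?_ ?_
    · rw [mem_nonZeroDivisors_iff_right]
      intro r hr
      obtain ⟨r, rfl⟩ := Ideal.Quotient.mk_surjective r
      rw [← map_mul, Ideal.Quotient.eq_zero_iff_mem, mul_comm] at hr
      exact Ideal.Quotient.eq_zero_iff_mem.2 (hx n (by omega) r hr)
    · rw [Ideal.Quotient.factor_mk, Ideal.Quotient.eq_zero_iff_mem]
      exact mem_partialIdeal _ _ (Nat.lt_succ_self n)

end RegularSequences

section Transfer

variable {A A' : Type*} [CommRing A] [CommRing A']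

theorem map_partialIdeal (φ : A →+* A') (J : Ideal A) (x : ℕ → A) (n : ℕ) :
    (partialIdeal J x n).map φ = partialIdeal (J.map φ) (fun i ↦ φ (x i)) n := by
  induction n with
  | zero => rfl
  | succ n ih => rw [partialIdeal, partialIdeal, Ideal.map_sup, ih, Ideal.map_span,
      Set.image_singleton]

theorem partialIdeal_eq_sup_span (J : Ideal A) (x : ℕ → A) (n : ℕ) :
    partialIdeal J x n = J ⊔ Ideal.span (Set.range fun i : Fin n ↦ x i) := by
  refine le_antisymm (partialIdeal_le le_sup_left fun i hi ↦ ?_) (sup_le (le_partialIdeal _ _ _) ?_)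
  · exact Ideal.mem_sup_right (Ideal.subset_span ⟨⟨i, hi⟩, rfl⟩)
  · rw [Ideal.span_le]
    rintro _ ⟨i, rfl⟩
    exact mem_partialIdeal _ _ i.2

theorem RegularMod.map_C {σ : Type*} {K : Ideal A} {x : A} (h : RegularMod K x) :
    RegularMod (K.map (MvPolynomial.C (σ := σ))) (MvPolynomial.C x) := by
  intro r hr
  rw [MvPolynomial.mem_map_C_iff] at hr ⊢
  intro d
  have := hr d
  rw [MvPolynomial.coeff_C_mul] at this
  exact h _ this

theorem RegularUpTo.map_C {σ : Type*} {J : Ideal A} {x : ℕ → A} {n : ℕ} (h : RegularUpTo J x n) :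
    RegularUpTo (J.map (MvPolynomial.C (σ := σ))) (fun i ↦ MvPolynomial.C (x i)) n := by
  intro i hi
  rw [← map_partialIdeal]
  exact (h i hi).map_C

end Transfer

open MvPolynomial in
theorem MvPolynomial.coeff_single_sum_X_mul_C {A ι τ : Type*} [CommRing A] [Fintype ι]
    {e : ι → τ} (he : Function.Injective e) (c : ι → A) (j : ι) :
    coeff (Finsupp.single (e j) 1) (∑ k, X (e k) * C (c k)) = c j := by
  classical
  rw [coeff_sum, Finset.sum_eq_single j]
  · rw [mul_comm, coeff_C_mul, coeff_X, if_pos rfl, mul_one]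
  · intro k _ hk
    rw [mul_comm, coeff_C_mul, coeff_X, if_neg, mul_zero]
    intro h
    exact hk (he (Finsupp.single_left_injective one_ne_zero h))
  · simp

open MvPolynomial in
/-- The `i`-th generic linear combination of the family `f`. -/
noncomputable def genericForm {B : Type} [CommRing B] {n g : ℕ} (f : Fin n → B) (i : Fin g) :
    MvPolynomial (Fin n × Fin g) B :=
  ∑ j : Fin n, X (j, i) * C (f j)

/-- The generic linear combinations of `f`, padded by zero to an infinite sequence. -/
noncomputable def genericSeq {B : Type} [CommRing B] {n g : ℕ} (f : Fin n → B) (i : ℕ) :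
    MvPolynomial (Fin n × Fin g) B :=
  if h : i < g then genericForm f ⟨i, h⟩ else 0

section GenericForms

variable {B : Type} [CommRing B] {n g : ℕ} {f : Fin n → B} {L : Ideal B}

theorem genericLinkIdeal_eq (f : Fin n → B) (L : Ideal B) :
    genericLinkIdeal g f L = Submodule.colon (Ideal.span (Set.range (genericForm (g := g) f)))
      (L.map (MvPolynomial.C (σ := Fin n × Fin g)) : Set _) := rfl

theorem coeff_genericForm (f : Fin n → B) (i : Fin g) (j : Fin n) :
    (genericForm f i).coeff (Finsupp.single (j, i) 1) = f j :=
  MvPolynomial.coeff_single_sum_X_mul_C (e := fun j ↦ (j, i)) (fun _ _ h ↦ (Prod.ext_iff.1 h).1) f j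

theorem genericSeq_coe (f : Fin n → B) (i : Fin g) : genericSeq f (i : ℕ) = genericForm f i :=
  dif_pos i.2

theorem partialIdeal_genericSeq (f : Fin n → B) :
    partialIdeal ⊥ (genericSeq (g := g) f) g = Ideal.span (Set.range (genericForm f)) := by
  rw [partialIdeal_eq_sup_span, bot_sup_eq]
  simp_rw [genericSeq_coe]

theorem genericForm_mem (hf : ∀ j, f j ∈ L) (i : Fin g) :
    genericForm f i ∈ L.map (MvPolynomial.C (σ := Fin n × Fin g)) :=
  Ideal.sum_mem _ fun j _ ↦ Ideal.mul_mem_left _ _ (Ideal.mem_map_of_mem _ (hf j))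

theorem genericSeq_mem (hf : ∀ j, f j ∈ L) (i : ℕ) :
    genericSeq f i ∈ L.map (MvPolynomial.C (σ := Fin n × Fin g)) := by
  unfold genericSeq
  split_ifs
  · exact genericForm_mem hf _
  · exact zero_mem _

theorem genericForm_mem_genericLinkIdeal (f : Fin n → B) (L : Ideal B) (i : Fin g) :
    genericForm f i ∈ genericLinkIdeal g f L := by
  rw [genericLinkIdeal_eq, Submodule.mem_colon]
  exact fun p _ ↦ Ideal.mul_mem_right _ _ (Ideal.subset_span ⟨i, rfl⟩)

theorem le_of_genericLinkIdeal_le (hf : Ideal.span (Set.range f) = L) (hg : 1 ≤ g)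
    {J : Ideal B} (h : genericLinkIdeal g f L ≤ J.map MvPolynomial.C) : L ≤ J := by
  rw [← hf, Ideal.span_le]
  rintro _ ⟨j, rfl⟩
  have := MvPolynomial.mem_map_C_iff.1 (h (genericForm_mem_genericLinkIdeal f L ⟨0, hg⟩))
    (Finsupp.single (j, ⟨0, hg⟩) 1)
  rwa [coeff_genericForm] at this

open MvPolynomial in
theorem regularMod_genericForm (hf : Ideal.span (Set.range f) = L) (i : Fin g)
    {K : Ideal (MvPolynomial (Fin n × Fin g) B)}
    (hK : ∃ s : Set ℕ, (∀ k ∈ s, k < i) ∧ K = Ideal.span (genericSeq f '' s))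
    (hLK : ColonTrivial (L.map C) K) : RegularMod K (genericForm f i) := by
  classical
  obtain ⟨s, hs, hKs⟩ := hK
  let θ : MvPolynomial (Fin n × Fin g) B →+*
      MvPolynomial (Fin n) (MvPolynomial (Fin n × Fin g) B) :=
    eval₂Hom (C.comp C) fun p ↦ if p.2 = i then X p.1 else C (X p)
  let π : MvPolynomial (Fin n) (MvPolynomial (Fin n × Fin g) B) →+*
      MvPolynomial (Fin n × Fin g) B :=
    eval₂Hom (RingHom.id _) fun j ↦ X (j, i)
  have hπC : π.comp C = RingHom.id _ := by
    exact RingHom.ext fun p ↦ by simp [π]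
  have hπθ : π.comp θ = RingHom.id _ := by
    refine MvPolynomial.ringHom_ext (fun b ↦ by simp [π, θ]) fun p ↦ ?_
    obtain ⟨j, k⟩ := p
    by_cases h : k = i
    · subst h
      simp [π, θ]
    · simp [π, θ, h]
  have hθi : θ (genericForm f i) = ∑ j, X j * C (C (f j)) := by
    simp [genericForm, θ]
  have hθs : ∀ k ∈ s, θ (genericSeq f k) = C (genericSeq f k) := by
    intro k hk
    have hki := hs k hk
    have hne : (⟨k, hki.trans i.2⟩ : Fin g) ≠ i := fun h ↦ hki.ne (congrArg Fin.val h)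
    rw [genericSeq, dif_pos (hki.trans i.2)]
    simp [genericForm, θ, hne]
  have hθK : K.map θ ≤ K.map C := by
    rw [hKs, Ideal.map_span, Ideal.map_span, Ideal.span_le]
    rintro _ ⟨_, ⟨k, hk, rfl⟩, rfl⟩
    rw [hθs k hk]
    exact Ideal.subset_span ⟨_, ⟨k, hk, rfl⟩, rfl⟩
  intro r hr
  have h1 : θ (genericForm f i) * θ r ∈ K.map C := by
    rw [← map_mul]
    exact hθK (Ideal.mem_map_of_mem _ hr)
  rw [hθi] at h1
  have h2 : θ r ∈ K.map C := by
    refine MvPolynomial.mem_map_C_of_mul_mem (fun a ha ↦ hLK a ?_) h1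
    have hle : L.map C ≤
        Submodule.comap (LinearMap.mulLeft (MvPolynomial (Fin n × Fin g) B) a) K := by
      rw [← hf, Ideal.map_span, Ideal.span_le]
      rintro _ ⟨_, ⟨j, rfl⟩, rfl⟩
      have := ha (Finsupp.single j 1)
      have hc := MvPolynomial.coeff_single_sum_X_mul_C (e := id) Function.injective_id
        (fun j ↦ (C (f j) : MvPolynomial (Fin n × Fin g) B)) j
      simp only [id] at hc
      rwa [hc] at this
    exact fun t ht ↦ hle ht
  have h3 : π (θ r) ∈ (K.map C).map π := Ideal.mem_map_of_mem _ h2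
  rw [Ideal.map_map, hπC, Ideal.map_id, ← RingHom.comp_apply, hπθ] at h3
  exact h3

theorem partialIdeal_bot_eq_span_image {A : Type*} [CommRing A] (x : ℕ → A) (n : ℕ) :
    partialIdeal ⊥ x n = Ideal.span (x '' Set.Iio n) := by
  rw [partialIdeal_eq_sup_span, bot_sup_eq]
  congr 1
  ext a
  simp [Fin.exists_iff]

/-- If an ideal contains a weakly regular sequence of length `g`, then `g` generic linear
combinations of generators form a weakly regular sequence. -/
theorem regularUpTo_genericSeq [IsNoetherianRing B] (hf : Ideal.span (Set.range f) = L)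
    {x : ℕ → B} (hx : RegularUpTo ⊥ x g) (hxL : ∀ i < g, x i ∈ L) :
    RegularUpTo ⊥ (genericSeq (g := g) f) g := by
  have hfL : ∀ j, f j ∈ L := fun j ↦ hf ▸ Ideal.subset_span ⟨j, rfl⟩
  have hxC : RegularUpTo ⊥ (fun i ↦ (MvPolynomial.C (x i) : MvPolynomial (Fin n × Fin g) B)) g := by
    simpa using hx.map_C (σ := Fin n × Fin g)
  have key : ∀ i ≤ g, RegularUpTo ⊥ (genericSeq (g := g) f) i := by
    intro i
    induction i with
    | zero => exact fun _ i hi ↦ absurd hi (Nat.not_lt_zero i)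
    | succ i ih =>
      intro hi k hk
      rcases Nat.lt_succ_iff_lt_or_eq.1 hk with hk | rfl
      · exact ih (by omega) k hk
      · rw [genericSeq_coe f ⟨k, hi⟩]
        refine regularMod_genericForm hf ⟨k, hi⟩
          ⟨Set.Iio k, fun _ h ↦ h, partialIdeal_bot_eq_span_image _ _⟩ ?_
        refine ColonTrivial.of_regularUpTo k
          (fun j hj ↦ Ideal.mem_map_of_mem _ (hxL j (hj.trans hi))) (fun j _ ↦ genericSeq_mem hfL j)
          (fun j hj ↦ hxC j (hj.trans hi)) (ih (by omega))
          ((hxC k hi).colonTrivial (Ideal.mem_map_of_mem _ (hxL k hi)))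
  exact key g le_rfl

end GenericForms

section FlatColon

theorem mem_map_colon_of_flat {B D : Type*} [CommRing B] [CommRing D] {φ : B →+* D} (hφ : φ.Flat)
    {c L : Ideal B} (hc : c.FG) (hL : L.FG) {u : D}
    (hu : ∀ t ∈ L, u * φ t ∈ c.map φ) : u ∈ (Submodule.colon c (L : Set B) : Ideal B).map φ := by
  let := φ.toAlgebra
  have hflat : Module.Flat B D := hφ
  obtain ⟨n, l, hl⟩ := Submodule.fg_iff_exists_fin_generating_family.1 hL
  obtain ⟨m, d, hd⟩ := Submodule.fg_iff_exists_fin_generating_family.1 hc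
  have hlL : ∀ j, l j ∈ L := fun j ↦ hl ▸ Submodule.subset_span ⟨j, rfl⟩
  have hv : ∀ j, ∃ v : Fin m → D, ∑ i, v i * φ (d i) = u * φ (l j) := by
    intro j
    have h := hu _ (hlL j)
    have hd' : c = Ideal.span (Set.range d) := hd.symm
    rw [hd', Ideal.map_span, ← Set.range_comp] at h
    exact (Submodule.mem_span_range_iff_exists_fun D).1 h
  choose v hv using hv
  let x : (Option (Fin n × Fin m) →₀ B) →ₗ[B] D :=
    Finsupp.linearCombination B fun o ↦ o.elim u fun p ↦ - v p.1 p.2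
  let f : (Fin n →₀ B) →ₗ[B] (Option (Fin n × Fin m) →₀ B) :=
    Finsupp.linearCombination B fun j ↦
      Finsupp.single none (l j) + ∑ i, Finsupp.single (some (j, i)) (d i)
  have hxf : x ∘ₗ f = 0 := by
    refine Finsupp.lhom_ext' fun j ↦ LinearMap.ext_ring ?_
    have h1 : ∀ (b : B) (z : D), b • z = φ b * z := fun b z ↦ rfl
    simp only [x, f, LinearMap.comp_apply, Finsupp.lsingle_apply,
      Finsupp.linearCombination_single, one_smul, map_add, map_sum, Option.elim, h1,
      LinearMap.zero_apply, mul_neg, Finset.sum_neg_distrib]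
    have := hv j
    simp only [mul_comm _ (φ _)] at this
    rw [this]
    ring
  obtain ⟨k, a, y, hxy, haf⟩ := Module.Flat.exists_factorization_of_comp_eq_zero_of_free hxf
  have hmem : ∀ s, a (Finsupp.single none 1) s ∈ (Submodule.colon c (L : Set B) : Ideal B) := by
    intro s
    rw [← hl, Submodule.colon_span, Submodule.mem_colon]
    rintro _ ⟨j, rfl⟩
    have h0 := congrArg (fun F ↦ (F (Finsupp.single j 1)) s) haf
    have h2 : ∀ (o) (b : B), Finsupp.single o b = b • (Finsupp.single o 1 :
      (Option (Fin n × Fin m) →₀ B)) := fun o b ↦ by simp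
    simp only [f, LinearMap.comp_apply, Finsupp.linearCombination_single, one_smul, map_add,
      map_sum, LinearMap.zero_apply] at h0
    rw [h2 none (l j)] at h0
    simp_rw [h2 (some _) (d _)] at h0
    simp only [map_smul, Finsupp.add_apply, Finsupp.smul_apply, smul_eq_mul,
      Finsupp.finsetSum_apply, Finsupp.zero_apply] at h0
    rw [smul_eq_mul, mul_comm, eq_neg_of_add_eq_zero_left h0, neg_mem_iff]
    refine Submodule.sum_mem _ fun i _ ↦ Ideal.mul_mem_right _ _ ?_
    rw [← hd]
    exact Submodule.subset_span ⟨i, rfl⟩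
  have hxu : x (Finsupp.single none 1) = u := by simp [x]
  rw [← hxu, hxy, LinearMap.comp_apply, ← Finsupp.sum_single (a (Finsupp.single none 1)),
    map_finsuppSum]
  refine Submodule.sum_mem _ fun s _ ↦ ?_
  beta_reduce
  rw [← mul_one (a (Finsupp.single none 1) s), ← smul_eq_mul, ← Finsupp.smul_single, map_smul]
  exact Ideal.mul_mem_right _ _ (Ideal.mem_map_of_mem φ (hmem s))

theorem map_colon_eq_of_flat {B D : Type*} [CommRing B] [CommRing D] {φ : B →+* D} (hφ : φ.Flat)
    {c L : Ideal B} (hc : c.FG) (hL : L.FG) :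
    (Submodule.colon c (L : Set B) : Ideal B).map φ =
      Submodule.colon (c.map φ) (L.map φ : Set D) := by
  refine le_antisymm ?_ fun u hu ↦ mem_map_colon_of_flat hφ hc hL fun t ht ↦
    Submodule.mem_colon.1 hu _ (Ideal.mem_map_of_mem _ ht)
  rw [Ideal.map_le_iff_le_comap]
  intro b hb
  rw [Ideal.mem_comap, Ideal.map, Ideal.map, Ideal.span, Submodule.colon_span, Submodule.mem_colon]
  rintro _ ⟨t, ht, rfl⟩
  rw [smul_eq_mul, ← map_mul]
  exact Ideal.mem_map_of_mem _ (Submodule.mem_colon.1 hb t ht)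

variable {A A' : Type*} [CommRing A] [IsNoetherianRing A] [CommRing A'] {φ : A →+* A'}

theorem RegularMod.map_of_flat (hφ : φ.Flat) {K : Ideal A} {x : A} (h : RegularMod K x) :
    RegularMod (K.map φ) (φ x) := by
  intro r hr
  have h1 : r ∈ (Submodule.colon K ((Ideal.span {x} : Ideal A) : Set A) : Ideal A).map φ := by
    refine mem_map_colon_of_flat hφ (IsNoetherian.noetherian _) (IsNoetherian.noetherian _) ?_
    intro t ht
    obtain ⟨w, rfl⟩ := Ideal.mem_span_singleton'.1 ht
    rw [map_mul, mul_left_comm, mul_comm r]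
    exact Ideal.mul_mem_left _ _ hr
  refine Ideal.map_mono (fun a ha ↦ h a ?_) h1
  rw [mul_comm]
  exact Submodule.mem_colon.1 ha _ (Ideal.mem_span_singleton_self x)

theorem RegularUpTo.map_of_flat (hφ : φ.Flat) {J : Ideal A} {x : ℕ → A} {n : ℕ}
    (h : RegularUpTo J x n) : RegularUpTo (J.map φ) (fun i ↦ φ (x i)) n := by
  intro i hi
  rw [← map_partialIdeal]
  exact (h i hi).map_of_flat hφ

end FlatColon

section FlatPolynomial

open MvPolynomial

theorem MvPolynomial.flat_C (A σ : Type*) [CommRing A] :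
    (C : A →+* MvPolynomial σ A).Flat :=
  RingHom.flat_algebraMap_iff.2 inferInstance

theorem MvPolynomial.flat_map {A A' σ : Type} [CommRing A] [CommRing A'] {u : A →+* A'}
    (hu : u.Flat) : (MvPolynomial.map (σ := σ) u).Flat := by
  algebraize [u]
  let := MvPolynomial.algebraMvPolynomial (R := A) (S := A') (σ := σ)
  have h : (algebraMap (MvPolynomial σ A) (MvPolynomial σ A')).Flat :=
    RingHom.Flat.isStableUnderBaseChange A A' (MvPolynomial σ A) (MvPolynomial σ A')
      (RingHom.flat_algebraMap_iff.2 inferInstance)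
  exact h

theorem MvPolynomial.flat_rename {D X X' Y : Type*} [CommRing D] (e : X ⊕ X' ≃ Y) :
    (rename (R := D) (e ∘ Sum.inl)).toRingHom.Flat := by
  let T : MvPolynomial X' (MvPolynomial X D) ≃ₐ[D] MvPolynomial Y D :=
    (sumAlgEquiv D X' X).symm.trans (renameEquiv D ((Equiv.sumComm X' X).trans e))
  have h : (rename (R := D) (e ∘ Sum.inl)).toRingHom = T.toAlgHom.toRingHom.comp C := by
    refine MvPolynomial.ringHom_ext (fun r ↦ ?_) fun i ↦ ?_
    · simp [T]
    · simp [T]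
  rw [h]
  exact (MvPolynomial.flat_C _ _).comp (RingHom.Flat.of_bijective T.bijective)

/-- The endomorphism of a polynomial ring in two families of variables translating the first family
by polynomials in the second one. -/
noncomputable def MvPolynomial.translate {D X X' : Type*} [CommRing D]
    (c : X → MvPolynomial X' D) : MvPolynomial (X ⊕ X') D →ₐ[D] MvPolynomial (X ⊕ X') D :=
  aeval (Sum.elim (fun x ↦ MvPolynomial.X (Sum.inl x) + rename Sum.inr (c x))
    fun x ↦ MvPolynomial.X (Sum.inr x))

theorem MvPolynomial.translate_comp_translate {D X X' : Type*} [CommRing D]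
    (c c' : X → MvPolynomial X' D) (h : ∀ x, c x + c' x = 0) :
    (translate c).comp (translate c') = AlgHom.id D _ := by
  have hr : (translate c).comp (rename Sum.inr) = rename Sum.inr := by
    refine MvPolynomial.algHom_ext fun i ↦ ?_
    simp [translate]
  refine MvPolynomial.algHom_ext fun i ↦ ?_
  rcases i with x | x
  · have h1 := DFunLike.congr_fun hr (c' x)
    rw [AlgHom.comp_apply] at h1
    rw [AlgHom.comp_apply, translate.eq_def c', aeval_X, Sum.elim_inl, map_add, h1]
    rw [translate, aeval_X, Sum.elim_inl, add_assoc, ← map_add, h, map_zero, add_zero]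
    rfl
  · simp [translate]

theorem MvPolynomial.exists_flat_hom {D X X' Y : Type*} [CommRing D] (e : X ⊕ X' ≃ Y)
    (c : X → MvPolynomial X' D) : ∃ G : MvPolynomial X D →+* MvPolynomial Y D, G.Flat ∧
      (∃ H : MvPolynomial Y D →+* MvPolynomial X D, H.comp G = RingHom.id _ ∧ H.comp C = C) ∧
      G.comp C = C ∧
      ∀ x, G (MvPolynomial.X x) = MvPolynomial.X (e (Sum.inl x)) + rename (e ∘ Sum.inr) (c x) := by
  have h1 := MvPolynomial.translate_comp_translate c (-c) (by simp)
  have h2 := MvPolynomial.translate_comp_translate (-c) c (by simp)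
  let T : MvPolynomial (X ⊕ X') D →ₐ[D] MvPolynomial Y D := (rename e).comp (translate c)
  let T' : MvPolynomial Y D →ₐ[D] MvPolynomial (X ⊕ X') D := (translate (-c)).comp (rename e.symm)
  have hT : ∀ p, T' (T p) = p := fun p ↦ by
    have := DFunLike.congr_fun h2 p
    simpa [T, T', rename_rename] using this
  have hT' : ∀ p, T (T' p) = p := fun p ↦ by
    have := DFunLike.congr_fun h1 (rename e.symm p)
    simp only [AlgHom.comp_apply, AlgHom.id_apply] at this
    simp [T, T', this, rename_rename]
  let κ : MvPolynomial (X ⊕ X') D →ₐ[D] MvPolynomial X D :=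
    aeval (Sum.elim MvPolynomial.X fun _ ↦ 0)
  have hκ : κ.comp (rename Sum.inl) = AlgHom.id D _ := by
    refine MvPolynomial.algHom_ext fun i ↦ ?_
    simp [κ]
  refine ⟨T.toRingHom.comp (rename Sum.inl).toRingHom, ?_,
    ⟨(κ.comp T').toRingHom, ?_, ?_⟩, ?_, ?_⟩
  · exact (MvPolynomial.flat_rename (Equiv.refl (X ⊕ X'))).comp
      (RingHom.Flat.of_bijective ⟨Function.LeftInverse.injective hT,
        Function.RightInverse.surjective hT'⟩)
  · refine RingHom.ext fun p ↦ ?_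
    change κ (T' (T (rename Sum.inl p))) = p
    rw [hT]
    exact DFunLike.congr_fun hκ p
  · exact RingHom.ext fun p ↦ AlgHom.commutes (κ.comp T') p
  · exact RingHom.ext fun p ↦ AlgHom.commutes (T.comp (rename Sum.inl)) p
  · intro x
    change T (rename Sum.inl (MvPolynomial.X x)) = _
    simp [T, translate, rename_rename]

end FlatPolynomial

section Grade

variable {A : Type} [CommRing A]

theorem partialIdeal_congr {J : Ideal A} {x y : ℕ → A} {n : ℕ} (h : ∀ i < n, x i = y i) :
    partialIdeal J x n = partialIdeal J y n := by
  induction n with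
  | zero => rfl
  | succ n ih =>
    rw [partialIdeal, partialIdeal, ih fun i hi ↦ h i (by omega), h n (by omega)]

theorem RegularUpTo.congr {J : Ideal A} {x y : ℕ → A} {n : ℕ} (hx : RegularUpTo J x n)
    (h : ∀ i < n, x i = y i) : RegularUpTo J y n := by
  intro i hi
  rw [← partialIdeal_congr fun j hj ↦ h j (hj.trans hi), ← h i hi]
  exact hx i hi

theorem bddAbove_length_isRegular (hdim : ringKrullDim A ≠ ⊤) (I : Ideal A) :
    BddAbove {n : ℕ | ∃ rs : List A, rs.length = n ∧ (∀ r ∈ rs, r ∈ I) ∧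
      RingTheory.Sequence.IsRegular A rs} := by
  have : ∃ N : ℕ, ringKrullDim A ≤ N := by
    rcases hA : ringKrullDim A with _ | _ | N
    · exact ⟨0, bot_le⟩
    · exact absurd hA hdim
    · exact ⟨N, le_rfl⟩
  obtain ⟨N, hN⟩ := this
  refine ⟨N, ?_⟩
  rintro _ ⟨rs, rfl, -, hrs⟩
  obtain ⟨h1, h2⟩ := (isRegular_iff_regularUpTo rs).1 hrs
  have := Ideal.Quotient.nontrivial_iff.2 h2
  have h3 := (ringKrullDim_quotient_partialIdeal_add_le h1).trans hN
  have h4 := ringKrullDim_nonneg_of_nontrivial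
    (R := A ⧸ partialIdeal ⊥ (fun j ↦ rs.getD j 0) rs.length)
  have h5 : ((rs.length : ℕ) : WithBot ℕ∞) ≤ N := (le_add_of_nonneg_left h4).trans h3
  exact_mod_cast h5

theorem le_gradeOf (hdim : ringKrullDim A ≠ ⊤) {I : Ideal A} {x : ℕ → A} {n : ℕ}
    (hx : RegularUpTo ⊥ x n) (hxI : ∀ i < n, x i ∈ I) (hne : partialIdeal ⊥ x n ≠ ⊤) :
    n ≤ gradeOf A I := by
  refine le_csSup (bddAbove_length_isRegular hdim I)
    ⟨List.ofFn fun i : Fin n ↦ x i, by simp, ?_, ?_⟩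
  · intro r hr
    obtain ⟨i, rfl⟩ := (List.mem_ofFn' _ _).1 hr
    exact hxI i i.2
  · have h : ∀ i < n, x i = (List.ofFn fun i : Fin n ↦ x i).getD i 0 := by
      intro i hi
      rw [List.getD_eq_getElem _ _ (by simpa using hi), List.getElem_ofFn]
    rw [isRegular_iff_regularUpTo, List.length_ofFn, ← partialIdeal_congr h]
    exact ⟨hx.congr h, hne⟩

theorem exists_regularUpTo_gradeOf [Nontrivial A] (hdim : ringKrullDim A ≠ ⊤) (I : Ideal A) :
    ∃ x : ℕ → A, RegularUpTo ⊥ x (gradeOf A I) ∧ ∀ i < gradeOf A I, x i ∈ I := by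
  have hne : {n : ℕ | ∃ rs : List A, rs.length = n ∧ (∀ r ∈ rs, r ∈ I) ∧
      RingTheory.Sequence.IsRegular A rs}.Nonempty := ⟨0, [], rfl, by simp, by
    rw [isRegular_iff_regularUpTo]
    exact ⟨fun i hi ↦ absurd hi (Nat.not_lt_zero i), bot_ne_top⟩⟩
  obtain ⟨rs, h1, h2, h3⟩ := Nat.sSup_mem hne (bddAbove_length_isRegular hdim I)
  change rs.length = gradeOf A I at h1
  rw [← h1]
  refine ⟨fun j ↦ rs.getD j 0, ((isRegular_iff_regularUpTo rs).1 h3).1, fun i hi ↦ h2 _ ?_⟩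
  beta_reduce
  rw [List.getD_eq_getElem _ _ hi]
  exact List.getElem_mem hi

theorem one_le_gradeOf (hdim : ringKrullDim A ≠ ⊤) {I : Ideal A}
    (h : ∃ r ∈ I, ¬ IsUnit r ∧ r ∈ nonZeroDivisors A) : 1 ≤ gradeOf A I := by
  obtain ⟨r, hrI, hru, hr⟩ := h
  refine le_gradeOf hdim (x := fun _ ↦ r) (fun i hi ↦ ?_) (fun _ _ ↦ hrI) ?_
  · obtain rfl : i = 0 := by omega
    intro s hs
    exact (mem_nonZeroDivisors_iff.1 hr).1 s hs
  · rw [partialIdeal, partialIdeal, bot_sup_eq, Ne, Ideal.span_singleton_eq_top]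
    exact hru

end Grade

theorem ringKrullDim_le_of_isLocalization {A S : Type*} [CommRing A] [CommRing S] [Algebra A S]
    (M : Submonoid A) [IsLocalization M S] : ringKrullDim S ≤ ringKrullDim A :=
  Order.krullDim_le_of_strictMono (PrimeSpectrum.comap (algebraMap A S))
    (Monotone.strictMono_of_injective (fun _ _ h ↦ Ideal.comap_mono h)
      (PrimeSpectrum.localization_comap_injective S M))

theorem RingHom.Flat.mem_nonZeroDivisors {A A' : Type*} [CommRing A] [IsNoetherianRing A]
    [CommRing A'] {φ : A →+* A'} (hφ : φ.Flat) {r : A} (hr : r ∈ nonZeroDivisors A) :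
    φ r ∈ nonZeroDivisors A' := by
  have h : RegularMod ⊥ r := fun s hs ↦ (mem_nonZeroDivisors_iff.1 hr).1 s hs
  have h' := h.map_of_flat hφ
  rw [Ideal.map_bot] at h'
  exact mem_nonZeroDivisors_iff.2 ⟨fun s hs ↦ h' s hs, fun s hs ↦ h' s ((mul_comm _ _).trans hs)⟩

section LinkStep

variable {B : Type} [CommRing B] {n g : ℕ} {f : Fin n → B} {L : Ideal B} {S : Type} [CommRing S]
  [Algebra (MvPolynomial (Fin n × Fin g) B) S]

theorem map_genericLinkIdeal_le_iff (M : Submonoid (MvPolynomial (Fin n × Fin g) B))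
    [IsLocalization M S] {𝔮 : Ideal B} (hp : 𝔮.IsPrime)
    (hM : ∀ s ∈ M, s ∉ 𝔮.map (MvPolynomial.C (σ := Fin n × Fin g))) :
    (genericLinkIdeal g f L).map (algebraMap (MvPolynomial (Fin n × Fin g) B) S) ≤
      (𝔮.map (MvPolynomial.C (σ := Fin n × Fin g))).map (algebraMap _ S) ↔
    genericLinkIdeal g f L ≤ 𝔮.map MvPolynomial.C := by
  rw [Ideal.map_le_iff_le_comap]
  have := IsLocalization.under_map_of_isPrime_disjoint M S (MvPolynomial.isPrime_map_C hp)
    (Set.disjoint_left.2 hM)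
  rw [← Ideal.under_def, this]

theorem gradeOf_map_genericLinkIdeal (M : Submonoid (MvPolynomial (Fin n × Fin g) B))
    [IsLocalization M S] [IsNoetherianRing B] (hf : Ideal.span (Set.range f) = L)
    (hdim : ringKrullDim S ≠ ⊤)
    {x : ℕ → B} (hx : RegularUpTo ⊥ x g) (hxL : ∀ i < g, x i ∈ L)
    (hne : (genericLinkIdeal g f L).map (algebraMap _ S) ≠ ⊤) :
    gradeOf S ((genericLinkIdeal g f L).map (algebraMap _ S)) = g := by
  set ψ := algebraMap (MvPolynomial (Fin n × Fin g) B) S with hψ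
  set Λ := (genericLinkIdeal g f L).map ψ with hΛ
  have hnt : Nontrivial S := by
    by_contra h
    rw [not_nontrivial_iff_subsingleton] at h
    exact hne (Subsingleton.elim _ _)
  have hS : IsNoetherianRing S := IsLocalization.isNoetherianRing M S inferInstance
  have hflat : ψ.Flat := RingHom.flat_algebraMap_iff.2 (IsLocalization.flat S M)
  set c : Ideal (MvPolynomial (Fin n × Fin g) B) := Ideal.span (Set.range (genericForm f)) with hc
  have hα : RegularUpTo ⊥ (fun i ↦ ψ (genericSeq f i)) g := by
    simpa using (regularUpTo_genericSeq hf hx hxL).map_of_flat hflat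
  have hcψ : partialIdeal ⊥ (fun i ↦ ψ (genericSeq f i)) g = c.map ψ := by
    rw [hc, ← partialIdeal_genericSeq, map_partialIdeal, Ideal.map_bot]
  have hαΛ : ∀ i < g, ψ (genericSeq f i) ∈ Λ := fun i hi ↦ by
    rw [genericSeq_coe f ⟨i, hi⟩]
    exact Ideal.mem_map_of_mem _ (genericForm_mem_genericLinkIdeal _ _ _)
  refine le_antisymm ?_ (le_gradeOf hdim hα hαΛ ?_)
  · by_contra! hlt
    obtain ⟨y, hy, hyΛ⟩ := exists_regularUpTo_gradeOf hdim Λ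
    have htriv := ColonTrivial.of_regularUpTo g (fun i hi ↦ hyΛ i (hi.trans hlt)) hαΛ
      (fun i hi ↦ hy i (hi.trans hlt)) hα ((hy g hlt).colonTrivial (hyΛ g hlt))
    rw [hcψ] at htriv
    refine hne ((Ideal.eq_top_iff_one _).2 (mem_map_colon_of_flat hflat
      (IsNoetherian.noetherian _) (IsNoetherian.noetherian _) fun t ht ↦ htriv _ fun u hu ↦ ?_))
    rw [hΛ, genericLinkIdeal_eq, map_colon_eq_of_flat hflat
      (IsNoetherian.noetherian _) (IsNoetherian.noetherian _)] at hu
    rw [one_mul, mul_comm]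
    exact Submodule.mem_colon.1 hu _ (Ideal.mem_map_of_mem _ ht)
  · exact fun h ↦ hne (top_le_iff.1 (h ▸ partialIdeal_le bot_le hαΛ))

end LinkStep

/-- A common generalization of generic and universal links, in which at each stage the polynomial
ring is localized at a set of elements outside the extension of the maximal ideal of `R`. -/
inductive IsLink (R : Type) [CommRing R] [IsLocalRing R] (I : Ideal R) :
    ℕ → (B : CommRingCat.{0}) → (R →+* B) → Ideal B → Prop
  | zero : IsLink R I 0 (CommRingCat.of R) (RingHom.id R) I
  | succ {e : ℕ} {B : CommRingCat.{0}} {φ : R →+* B} {L : Ideal B}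
      (h : IsLink R I e B φ L) (n : ℕ) (f : Fin n → B) (hf : Ideal.span (Set.range f) = L)
      (S : CommRingCat.{0}) (ψ : MvPolynomial (Fin n × Fin (gradeOf B L)) B →+* S)
      (M : Submonoid (MvPolynomial (Fin n × Fin (gradeOf B L)) B))
      (hM : ∀ s ∈ M, s ∉ ((maximalIdeal R).map φ).map
        (MvPolynomial.C (σ := Fin n × Fin (gradeOf B L))))
      (hψ : @IsLocalization _ _ M S _ ψ.toAlgebra) :
      IsLink R I (e + 1) S
        (ψ.comp ((MvPolynomial.C : B →+* MvPolynomial (Fin n × Fin (gradeOf B L)) B).comp φ))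
        ((genericLinkIdeal (gradeOf B L) f L).map ψ)

/-- Properties of a ring and an ideal that persist under taking links. -/
structure IsLinkData {R : Type} [CommRing R] [IsLocalRing R] (I : Ideal R) {B : Type} [CommRing B]
    (φ : R →+* B) (L : Ideal B) : Prop where
  isNoetherianRing : IsNoetherianRing B
  ringKrullDim_ne_top : ringKrullDim B ≠ ⊤
  flat : φ.Flat
  isPrime : ((maximalIdeal R).map φ).IsPrime
  exists_mem : ∃ r ∈ L, ¬ IsUnit r ∧ r ∈ nonZeroDivisors B
  gradeOf_eq : L ≤ (maximalIdeal R).map φ → gradeOf B L = gradeOf R I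

theorem IsLinkData.succ {R : Type} [CommRing R] [IsLocalRing R] [IsNoetherianRing R] {I : Ideal R}
    (hI : ∃ r ∈ I, ¬ IsUnit r ∧ r ∈ nonZeroDivisors R) {B : Type} [CommRing B]
    {φ : R →+* B} {L : Ideal B} (h : IsLinkData I φ L) {n g : ℕ} (hg : gradeOf B L = g)
    {f : Fin n → B}
    (hf : Ideal.span (Set.range f) = L) {S : Type} [CommRing S]
    [Algebra (MvPolynomial (Fin n × Fin g) B) S]
    (M : Submonoid (MvPolynomial (Fin n × Fin g) B)) [IsLocalization M S]
    (hM : ∀ s ∈ M, s ∉ ((maximalIdeal R).map φ).map (MvPolynomial.C (σ := Fin n × Fin g))) :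
    IsLinkData I ((algebraMap (MvPolynomial (Fin n × Fin g) B) S).comp (MvPolynomial.C.comp φ))
      ((genericLinkIdeal g f L).map (algebraMap _ S)) := by
  have := h.isNoetherianRing
  have hflatS : (algebraMap (MvPolynomial (Fin n × Fin g) B) S).Flat :=
    RingHom.flat_algebraMap_iff.2 (IsLocalization.flat S M)
  have hnt : Nontrivial B := by
    by_contra hB
    rw [not_nontrivial_iff_subsingleton] at hB
    exact h.isPrime.ne_top (Subsingleton.elim _ _)
  obtain ⟨x, hx, hxL⟩ := exists_regularUpTo_gradeOf h.ringKrullDim_ne_top L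
  rw [hg] at hx hxL
  have hg1 : 1 ≤ g := hg ▸ one_le_gradeOf h.ringKrullDim_ne_top h.exists_mem
  have hdim : ringKrullDim S ≠ ⊤ := by
    refine (lt_of_le_of_lt (ringKrullDim_le_of_isLocalization M) (lt_top_iff_ne_top.2 ?_)).ne
    rw [MvPolynomial.ringKrullDim_of_isNoetherianRing]
    rcases hB : ringKrullDim B with _ | _ | N
    · exact bot_ne_top
    · exact absurd hB h.ringKrullDim_ne_top
    · exact (WithBot.coe_lt_coe.2 (ENat.natCast_lt_top (N + Nat.card (Fin n × Fin g)))).ne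
  let P := MvPolynomial (Fin n × Fin g) B
  have hflat : ((algebraMap P S).comp (MvPolynomial.C.comp φ)).Flat :=
    (h.flat.comp (MvPolynomial.flat_C _ _)).comp hflatS
  have hmap : (maximalIdeal R).map ((algebraMap P S).comp (MvPolynomial.C.comp φ)) =
      (((maximalIdeal R).map φ).map MvPolynomial.C).map (algebraMap P S) := by
    rw [Ideal.map_map, Ideal.map_map]
    rfl
  have hprime : ((maximalIdeal R).map
      ((algebraMap P S).comp (MvPolynomial.C.comp φ))).IsPrime := by
    rw [hmap]
    exact IsLocalization.isPrime_of_isPrime_disjoint M S _ (MvPolynomial.isPrime_map_C h.isPrime)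
      (Set.disjoint_left.2 hM)
  refine ⟨IsLocalization.isNoetherianRing M S inferInstance, hdim, hflat, hprime, ?_, ?_⟩
  · by_cases hne : (genericLinkIdeal g f L).map (algebraMap _ S) = ⊤
    · obtain ⟨r, -, hru, hr⟩ := hI
      refine ⟨_, hne ▸ Submodule.mem_top, fun hu ↦ ?_, hflat.mem_nonZeroDivisors hr⟩
      exact hprime.ne_top (Ideal.eq_top_of_isUnit_mem _
        (Ideal.mem_map_of_mem _ ((mem_maximalIdeal r).2 hru)) hu)
    · refine ⟨algebraMap _ S (genericForm f ⟨0, hg1⟩), Ideal.mem_map_of_mem _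
        (genericForm_mem_genericLinkIdeal _ _ _), fun hu ↦ hne (Ideal.eq_top_of_isUnit_mem _
        (Ideal.mem_map_of_mem _ (genericForm_mem_genericLinkIdeal _ _ _)) hu), ?_⟩
      refine hflatS.mem_nonZeroDivisors ?_
      have := regularUpTo_genericSeq hf hx hxL 0 hg1
      rw [genericSeq_coe f ⟨0, hg1⟩] at this
      exact mem_nonZeroDivisors_iff.2 ⟨fun s hs ↦ this s hs,
        fun s hs ↦ this s ((mul_comm _ _).trans hs)⟩
  · intro hle
    rw [gradeOf_map_genericLinkIdeal M hf hdim hx hxL fun htop ↦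
      hprime.ne_top (top_le_iff.1 (htop ▸ hle)), ← hg]
    rw [hmap, map_genericLinkIdeal_le_iff M h.isPrime hM] at hle
    exact h.gradeOf_eq (le_of_genericLinkIdeal_le hf hg1 hle)

theorem IsLink.isLinkData {R : Type} [CommRing R] [IsLocalRing R] [IsNoetherianRing R] {I : Ideal R}
    (hI : ∃ r ∈ I, ¬ IsUnit r ∧ r ∈ nonZeroDivisors R) {e : ℕ} {B : CommRingCat.{0}}
    {φ : R →+* B} {L : Ideal B} (h : IsLink R I e B φ L) : IsLinkData I φ L := by
  induction h with
  | zero =>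
    refine ⟨‹_›, ringKrullDim_ne_top, RingHom.Flat.id R, ?_, hI, fun _ ↦ rfl⟩
    rw [Ideal.map_id]
    infer_instance
  | succ h n f hf S ψ M hM hψ ih =>
    let := ψ.toAlgebra
    exact ih.succ hI rfl hf M hM

/-- A flat extension `u` of `R`-algebras such that ideals extended from `R` contract to ideals
extended from `R`. -/
structure IsPureExtension {R B D : Type} [CommRing R] [CommRing B] [CommRing D] (φ : R →+* B)
    (χ : R →+* D) (u : B →+* D) : Prop where
  flat : u.Flat
  comp_eq : u.comp φ = χ
  comap_le : ∀ J : Ideal R, (J.map χ).comap u ≤ J.map φ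

section PureExtension

variable {R B D S : Type} [CommRing R] [CommRing B] [CommRing D] [CommRing S] {φ : R →+* B}
  {χ : R →+* D} {u : B →+* D}

theorem IsPureExtension.le_iff (h : IsPureExtension φ χ u) {L : Ideal B} {J : Ideal R} :
    L ≤ J.map φ ↔ L.map u ≤ J.map χ := by
  constructor
  · intro hL
    rw [← h.comp_eq, ← Ideal.map_map]
    exact Ideal.map_mono hL
  · intro hL
    exact (Ideal.map_le_iff_le_comap.1 hL).trans (h.comap_le J)

open MvPolynomial in
theorem IsPureExtension.mvPolynomial {X Y : Type} (h : IsPureExtension φ χ u)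
    {G : MvPolynomial X D →+* MvPolynomial Y D} (hG : G.Flat)
    (hH : ∃ H : MvPolynomial Y D →+* MvPolynomial X D, H.comp G = RingHom.id _ ∧ H.comp C = C)
    (hGC : G.comp C = C) :
    IsPureExtension (C.comp φ : R →+* MvPolynomial X B) (C.comp χ : R →+* MvPolynomial Y D)
      (G.comp (MvPolynomial.map u)) := by
  refine ⟨(MvPolynomial.flat_map h.flat).comp hG, ?_, fun J p hp ↦ ?_⟩
  · ext r
    have h1 := RingHom.congr_fun hGC (χ r)
    have h2 := RingHom.congr_fun h.comp_eq r
    simp only [RingHom.comp_apply] at h1 h2 ⊢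
    rw [MvPolynomial.map_C, h2, h1]
  · obtain ⟨H, hHG, hHC⟩ := hH
    have h1 : H (G (MvPolynomial.map u p)) ∈ ((J.map χ).map C).map H := by
      rw [Ideal.map_map χ C]
      exact Ideal.mem_map_of_mem _ hp
    rw [Ideal.map_map, hHC, ← RingHom.comp_apply, hHG, RingHom.id_apply,
      MvPolynomial.mem_map_C_iff] at h1
    rw [← Ideal.map_map, MvPolynomial.mem_map_C_iff]
    intro d
    have := h1 d
    rw [MvPolynomial.coeff_map] at this
    exact h.comap_le J this

theorem IsPureExtension.exists_localization [Algebra B S] (M : Submonoid B)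
    [IsLocalization M S] (h : IsPureExtension φ χ u) {𝔪 : Ideal R}
    (hM : ∀ s ∈ M, s ∉ 𝔪.map φ) (hp : (𝔪.map χ).IsPrime)
    (hreg : ∀ (J : Ideal R) (t q : D), t ∉ 𝔪.map χ → t * q ∈ J.map χ → q ∈ J.map χ) :
    ∃ v : S →+* Localization.AtPrime (𝔪.map χ),
      v.comp (algebraMap B S) = (algebraMap D _).comp u ∧
      IsPureExtension ((algebraMap B S).comp φ) ((algebraMap D _).comp χ) v := by
  have hunit : ∀ s : M, IsUnit (((algebraMap D (Localization.AtPrime (𝔪.map χ))).comp u) s) := by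
    intro s
    refine IsLocalization.map_units (Localization.AtPrime (𝔪.map χ))
      (⟨u s, fun hs ↦ hM s s.2 (h.comap_le 𝔪 hs)⟩ : (𝔪.map χ).primeCompl)
  let v : S →+* Localization.AtPrime (𝔪.map χ) := IsLocalization.lift hunit
  have hv : v.comp (algebraMap B S) = (algebraMap D _).comp u := IsLocalization.lift_comp hunit
  refine ⟨v, hv, ?_, ?_, fun J s hs ↦ ?_⟩
  · have h1 : (v.comp (algebraMap B S)).Flat := by
      rw [hv]
      exact h.flat.comp (RingHom.flat_algebraMap_iff.2 (IsLocalization.flat _ (𝔪.map χ).primeCompl))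
    let := v.toAlgebra
    let := (v.comp (algebraMap B S)).toAlgebra
    have : IsScalarTower B S (Localization.AtPrime (𝔪.map χ)) :=
      IsScalarTower.of_algebraMap_eq fun _ ↦ rfl
    exact (Module.flat_iff_of_isLocalization S M _).2 h1
  · rw [← RingHom.comp_assoc, hv, RingHom.comp_assoc, h.comp_eq]
  · obtain ⟨⟨p, m⟩, hpm⟩ := IsLocalization.surj M s
    have h1 : v (algebraMap B S p) ∈ J.map ((algebraMap D _).comp χ) := by
      rw [← hpm, map_mul]
      exact Ideal.mul_mem_right _ _ hs
    rw [← RingHom.comp_apply, hv, RingHom.comp_apply, ← Ideal.map_map,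
      IsLocalization.algebraMap_mem_map_algebraMap_iff (𝔪.map χ).primeCompl] at h1
    obtain ⟨t, ht, htp⟩ := h1
    have h2 := h.comap_le J (hreg J t (u p) ht htp)
    have h3 : s * algebraMap B S m ∈ (J.map φ).map (algebraMap B S) := by
      rw [hpm]
      exact Ideal.mem_map_of_mem _ h2
    rw [← Ideal.map_map]
    exact (Ideal.mul_unit_mem_iff_mem _ (IsLocalization.map_units S m)).1 h3

end PureExtension

/-- Two ideals in `R`-algebras become equal in a common local pure extension. -/
def IsComparable {R B B' : Type} [CommRing R] [IsLocalRing R] [CommRing B] [CommRing B']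
    (φ : R →+* B) (L : Ideal B) (φ' : R →+* B') (L' : Ideal B') : Prop :=
  ∃ (D : Type) (_ : CommRing D) (_ : IsLocalRing D) (χ : R →+* D) (u : B →+* D) (u' : B' →+* D),
    maximalIdeal D = (maximalIdeal R).map χ ∧ IsPureExtension φ χ u ∧ IsPureExtension φ' χ u' ∧
      L.map u = L'.map u'

theorem IsComparable.le_iff {R B B' : Type} [CommRing R] [IsLocalRing R] [CommRing B] [CommRing B']
    {φ : R →+* B} {L : Ideal B} {φ' : R →+* B'} {L' : Ideal B'} (h : IsComparable φ L φ' L')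
    (J : Ideal R) : L ≤ J.map φ ↔ L' ≤ J.map φ' := by
  obtain ⟨D, _, _, χ, u, u', -, hu, hu', hL⟩ := h
  rw [hu.le_iff, hL, hu'.le_iff]

section ComparisonStep

variable {R B D : Type} [CommRing R] [CommRing B] [IsNoetherianRing B]
  [CommRing D] {φ : R →+* B} {χ : R →+* D} {u : B →+* D}
  {n g : ℕ} {f : Fin n → B} {L : Ideal B} {Y : Type}

open MvPolynomial in
theorem map_genericLinkIdeal {G : MvPolynomial (Fin n × Fin g) D →+* MvPolynomial Y D}
    (hu : u.Flat) (hG : G.Flat) (hGC : G.comp C = C) :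
    (genericLinkIdeal g f L).map (G.comp (MvPolynomial.map u)) =
      Submodule.colon (Ideal.span (Set.range fun i ↦ ∑ j, G (X (j, i)) * C (u (f j))))
        (((L.map u).map (C (σ := Y)) : Ideal _) : Set (MvPolynomial Y D)) := by
  have hC : ∀ d, G (C d) = C d := RingHom.congr_fun hGC
  have hfun : ⇑(G.comp (MvPolynomial.map u)) ∘ genericForm f =
      fun i : Fin g ↦ ∑ j, G (X (j, i)) * C (u (f j)) := by
    funext i
    simp [genericForm, hC]
  have hcomp : (G.comp (MvPolynomial.map u)).comp C = (C (σ := Y)).comp u := by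
    ext1 b
    simp [hC]
  rw [genericLinkIdeal_eq, map_colon_eq_of_flat ((MvPolynomial.flat_map hu).comp hG)
    (IsNoetherian.noetherian _) (IsNoetherian.noetherian _), Ideal.map_span, ← Set.range_comp,
    Ideal.map_map, Ideal.map_map, hfun, hcomp]

/-- The generic form in the concatenation of two families of elements is the image of the generic
form in the first one under a flat substitution, provided that the first family generates the
ideal generated by both. -/
theorem exists_substitution {n n' g : ℕ} {F : Fin n → D} {F' : Fin n' → D}
    {Y : Type} (e : (Fin n × Fin g) ⊕ (Fin n' × Fin g) ≃ Y)
    (hF : ∀ j', F' j' ∈ Ideal.span (Set.range F)) :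
    ∃ G : MvPolynomial (Fin n × Fin g) D →+* MvPolynomial Y D, G.Flat ∧
      (∃ H : MvPolynomial Y D →+* MvPolynomial (Fin n × Fin g) D,
        H.comp G = RingHom.id _ ∧ H.comp MvPolynomial.C = MvPolynomial.C) ∧
      G.comp MvPolynomial.C = MvPolynomial.C ∧
      ∀ i, ∑ j, G (MvPolynomial.X (j, i)) * MvPolynomial.C (F j) =
        ∑ j, MvPolynomial.X (e (Sum.inl (j, i))) * MvPolynomial.C (F j) +
          ∑ j', MvPolynomial.X (e (Sum.inr (j', i))) * MvPolynomial.C (F' j') := by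
  have ha : ∀ j', ∃ a : Fin n → D, ∑ j, a j * F j = F' j' := fun j' ↦
    (Submodule.mem_span_range_iff_exists_fun D).1 (hF j')
  choose a ha using ha
  obtain ⟨G, h1, h2, h3, h4⟩ := MvPolynomial.exists_flat_hom e fun x : Fin n × Fin g ↦
    ∑ j', MvPolynomial.C (a j' x.1) * MvPolynomial.X (j', x.2)
  refine ⟨G, h1, h2, h3, fun i ↦ ?_⟩
  simp only [h4, add_mul, Finset.sum_add_distrib, map_sum, map_mul, MvPolynomial.rename_C,
    MvPolynomial.rename_X, Function.comp_apply, Finset.sum_mul]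
  congr 1
  rw [Finset.sum_comm]
  refine Finset.sum_congr rfl fun j' _ ↦ ?_
  rw [← ha j', map_sum, Finset.mul_sum]
  refine Finset.sum_congr rfl fun j _ ↦ ?_
  rw [map_mul]
  ring

end ComparisonStep

section Comparison

variable {R : Type} [CommRing R] [IsLocalRing R] {D : Type} [CommRing D] [IsLocalRing D]
  {χ : R →+* D}

/-- One stage of linkage extends to the localized polynomial ring over `D`. -/
theorem exists_extension_genericLinkIdeal
    {B S Y : Type} [CommRing B] [IsNoetherianRing B] [CommRing S] [Finite Y]
    (hD : maximalIdeal D = (maximalIdeal R).map χ)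
    (hp : ((maximalIdeal R).map ((MvPolynomial.C : D →+* MvPolynomial Y D).comp χ)).IsPrime)
    {φ : R →+* B} {u : B →+* D} (hu : IsPureExtension φ χ u) {n g : ℕ} {f : Fin n → B}
    {L : Ideal B} (hf : Ideal.span (Set.range f) = L) {ψ : MvPolynomial (Fin n × Fin g) B →+* S}
    {M : Submonoid (MvPolynomial (Fin n × Fin g) B)}
    (hM : ∀ s ∈ M, s ∉ ((maximalIdeal R).map φ).map (MvPolynomial.C (σ := Fin n × Fin g)))
    (hψ : @IsLocalization _ _ M S _ ψ.toAlgebra)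
    {G : MvPolynomial (Fin n × Fin g) D →+* MvPolynomial Y D} (hG : G.Flat)
    (hH : ∃ H : MvPolynomial Y D →+* MvPolynomial (Fin n × Fin g) D,
        H.comp G = RingHom.id _ ∧ H.comp MvPolynomial.C = MvPolynomial.C)
    (hGC : G.comp MvPolynomial.C = MvPolynomial.C) :
    ∃ v : S →+* Localization.AtPrime
        ((maximalIdeal R).map ((MvPolynomial.C : D →+* MvPolynomial Y D).comp χ)),
      IsPureExtension (ψ.comp (MvPolynomial.C.comp φ))
        ((algebraMap _ _).comp ((MvPolynomial.C : D →+* MvPolynomial Y D).comp χ)) v ∧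
      ((genericLinkIdeal g f L).map ψ).map v =
        (Submodule.colon
          (Ideal.span (Set.range fun i ↦ ∑ j, G (MvPolynomial.X (j, i)) * MvPolynomial.C (u (f j))))
          (((L.map u).map (MvPolynomial.C (σ := Y)) : Ideal _) : Set (MvPolynomial Y D)) :
            Ideal (MvPolynomial Y D)).map (algebraMap _ _) ∧
      (1 ≤ g → L.map u = ⊤ → ((genericLinkIdeal g f L).map ψ).map v = ⊤) := by
  let := ψ.toAlgebra
  have hpure := hu.mvPolynomial hG hH hGC
  obtain ⟨v, hv, hvp⟩ := hpure.exists_localization (S := S) M (𝔪 := maximalIdeal R)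
    (by rwa [← Ideal.map_map]) hp (by
      intro J t q ht htq
      rw [← Ideal.map_map] at ht htq ⊢
      rw [← hD] at ht
      exact MvPolynomial.mem_map_C_of_mul_mem_of_notMem ht htq)
  have hmap : ((genericLinkIdeal g f L).map ψ).map v =
      ((genericLinkIdeal g f L).map (G.comp (MvPolynomial.map u))).map (algebraMap _ _) := by
    rw [Ideal.map_map, Ideal.map_map]
    exact congrArg (fun F ↦ Ideal.map F _) hv
  refine ⟨v, hvp, ?_, fun hg hL ↦ ?_⟩
  · rw [hmap, map_genericLinkIdeal hu.flat hG hGC]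
  · rw [hmap]
    by_contra hne
    have hle := IsLocalRing.le_maximalIdeal hne
    rw [Ideal.map_le_iff_le_comap, ← Ideal.under_def,
      IsLocalization.AtPrime.under_maximalIdeal _ ((maximalIdeal R).map (MvPolynomial.C.comp χ)),
      ← hpure.le_iff, ← Ideal.map_map] at hle
    have := hu.le_iff.1 (le_of_genericLinkIdeal_le hf hg hle)
    rw [hL, ← hD] at this
    exact (maximalIdeal.isMaximal D).ne_top (top_le_iff.1 this)

end Comparison

theorem IsComparable.succ {R : Type} [CommRing R] [IsLocalRing R] {I : Ideal R}
    {B : Type} [CommRing B] {φ : R →+* B} {L : Ideal B} (hB : IsLinkData I φ L)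
    {B' : Type} [CommRing B'] {φ' : R →+* B'} {L' : Ideal B'} (hB' : IsLinkData I φ' L')
    (h : IsComparable φ L φ' L')
    {n g : ℕ} (hg : gradeOf B L = g) {f : Fin n → B} (hf : Ideal.span (Set.range f) = L)
    {S : Type} [CommRing S] {ψ : MvPolynomial (Fin n × Fin g) B →+* S}
    {M : Submonoid (MvPolynomial (Fin n × Fin g) B)}
    (hM : ∀ s ∈ M, s ∉ ((maximalIdeal R).map φ).map (MvPolynomial.C (σ := Fin n × Fin g)))
    (hψ : @IsLocalization _ _ M S _ ψ.toAlgebra)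
    {n' g' : ℕ} (hg' : gradeOf B' L' = g') {f' : Fin n' → B'}
    (hf' : Ideal.span (Set.range f') = L')
    {S' : Type} [CommRing S'] {ψ' : MvPolynomial (Fin n' × Fin g') B' →+* S'}
    {M' : Submonoid (MvPolynomial (Fin n' × Fin g') B')}
    (hM' : ∀ s ∈ M', s ∉ ((maximalIdeal R).map φ').map (MvPolynomial.C (σ := Fin n' × Fin g')))
    (hψ' : @IsLocalization _ _ M' S' _ ψ'.toAlgebra) :
    IsComparable (ψ.comp (MvPolynomial.C.comp φ)) ((genericLinkIdeal g f L).map ψ)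
      (ψ'.comp (MvPolynomial.C.comp φ')) ((genericLinkIdeal g' f' L').map ψ') := by
  obtain ⟨D, _, _, χ, u, u', hD, hu, hu', hL⟩ := h
  have := hB.isNoetherianRing
  have := hB'.isNoetherianRing
  have hg1 : 1 ≤ g := hg ▸ one_le_gradeOf hB.ringKrullDim_ne_top hB.exists_mem
  have hg1' : 1 ≤ g' := hg' ▸ one_le_gradeOf hB'.ringKrullDim_ne_top hB'.exists_mem
  let Y := (Fin n × Fin g) ⊕ (Fin n' × Fin g')
  have hp : ((maximalIdeal R).map ((MvPolynomial.C : D →+* MvPolynomial Y D).comp χ)).IsPrime := by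
    rw [← Ideal.map_map, ← hD]
    exact MvPolynomial.isPrime_map_C (maximalIdeal.isMaximal D).isPrime
  have hmax : maximalIdeal (Localization.AtPrime
      ((maximalIdeal R).map ((MvPolynomial.C : D →+* MvPolynomial Y D).comp χ))) =
      (maximalIdeal R).map ((algebraMap _ _).comp
        ((MvPolynomial.C : D →+* MvPolynomial Y D).comp χ)) := by
    rw [← Localization.AtPrime.map_eq_maximalIdeal, Ideal.map_map]
  by_cases htop : L.map u = ⊤
  · obtain ⟨G, hG, hH, hGC, -⟩ := MvPolynomial.exists_flat_hom (D := D) (Equiv.refl Y) fun _ ↦ 0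
    obtain ⟨G', hG', hH', hGC', -⟩ := MvPolynomial.exists_flat_hom (D := D)
      (Equiv.sumComm (Fin n' × Fin g') (Fin n × Fin g)) fun _ ↦ 0
    obtain ⟨v, hv, -, hvL⟩ := exists_extension_genericLinkIdeal hD hp hu hf hM hψ hG hH hGC
    obtain ⟨v', hv', -, hvL'⟩ :=
      exists_extension_genericLinkIdeal hD hp hu' hf' hM' hψ' hG' hH' hGC'
    exact ⟨_, _, _, _, v, v', hmax, hv, hv',
      (hvL hg1 htop).trans (hvL' hg1' (hL ▸ htop)).symm⟩
  · have hle : L.map u ≤ (maximalIdeal R).map χ := hD ▸ IsLocalRing.le_maximalIdeal htop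
    obtain rfl : g = g' := by
      rw [← hg, ← hg', hB.gradeOf_eq (hu.le_iff.2 hle), hB'.gradeOf_eq (hu'.le_iff.2 (hL ▸ hle))]
    have hspan : Ideal.span (Set.range fun j ↦ u (f j)) = L.map u := by
      rw [← hf, Ideal.map_span, ← Set.range_comp]
      rfl
    have hspan' : Ideal.span (Set.range fun j ↦ u' (f' j)) = L.map u := by
      rw [hL, ← hf', Ideal.map_span, ← Set.range_comp]
      rfl
    obtain ⟨G, hG, hH, hGC, hGβ⟩ := exists_substitution (F := fun j ↦ u (f j))
      (F' := fun j ↦ u' (f' j)) (Equiv.refl Y) fun j ↦ by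
        rw [hspan, ← hspan']
        exact Ideal.subset_span ⟨j, rfl⟩
    obtain ⟨G', hG', hH', hGC', hGβ'⟩ := exists_substitution (F := fun j ↦ u' (f' j))
      (F' := fun j ↦ u (f j)) (Equiv.sumComm (Fin n' × Fin g) (Fin n × Fin g)) fun j ↦ by
        rw [hspan', ← hspan]
        exact Ideal.subset_span ⟨j, rfl⟩
    obtain ⟨v, hv, hvL, -⟩ := exists_extension_genericLinkIdeal hD hp hu hf hM hψ hG hH hGC
    obtain ⟨v', hv', hvL', -⟩ :=
      exists_extension_genericLinkIdeal hD hp hu' hf' hM' hψ' hG' hH' hGC'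
    refine ⟨_, _, _, _, v, v', hmax, hv, hv', ?_⟩
    rw [hvL, hvL', hL]
    simp_rw [hGβ, hGβ']
    simp only [Equiv.sumComm_apply, Sum.swap_inl, Sum.swap_inr, add_comm]
    rfl

theorem IsLink.isComparable {R : Type} [CommRing R] [IsLocalRing R] [IsNoetherianRing R]
    {I : Ideal R} (hI : ∃ r ∈ I, ¬ IsUnit r ∧ r ∈ nonZeroDivisors R) {e : ℕ}
    {B B' : CommRingCat.{0}} {φ : R →+* B} {φ' : R →+* B'} {L : Ideal B} {L' : Ideal B'}
    (h : IsLink R I e B φ L) (h' : IsLink R I e B' φ' L') : IsComparable φ L φ' L' := by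
  induction h generalizing B' φ' L' with
  | zero =>
    cases h'
    have hid : IsPureExtension (RingHom.id R) (RingHom.id R) (RingHom.id R) :=
      ⟨RingHom.Flat.id R, rfl, fun _ ↦ le_of_eq (Ideal.comap_id _)⟩
    exact ⟨R, _, inferInstance, RingHom.id R, RingHom.id R, RingHom.id R, (Ideal.map_id _).symm,
      hid, hid, rfl⟩
  | succ h n f hf S ψ M hM hψ ih =>
    cases h' with
    | succ h' n' f' hf' S' ψ' M' hM' hψ' =>
      exact (ih h').succ (h.isLinkData hI) (h'.isLinkData hI) rfl hf hM hψ rfl hf' hM' hψ'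

theorem IsLocalization.toAlgebra_algebraMap {A S : Type*} [CommRing A] [CommRing S] [Algebra A S]
    (M : Submonoid A) [h : IsLocalization M S] :
    @IsLocalization _ _ M S _ (algebraMap A S).toAlgebra := by
  have : (algebraMap A S).toAlgebra = ‹Algebra A S› := Algebra.algebra_ext _ _ fun _ ↦ rfl
  rwa [this]

theorem IsGenericLinkOf.isLink {R : Type} [CommRing R] [IsLocalRing R] [IsNoetherianRing R]
    {I : Ideal R} (hI : ∃ r ∈ I, ¬ IsUnit r ∧ r ∈ nonZeroDivisors R) {e : ℕ}
    {B : CommRingCat.{0}} {φ : R →+* B} {L : Ideal B} (h : IsGenericLinkOf R e I B φ L) :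
    IsLink R I e B φ L := by
  induction h with
  | zero => exact .zero
  | @succ e I B φ L h n f hf ih =>
    have hL := ih hI
    have hloc : IsLocalization (⊥ : Submonoid (MvPolynomial (Fin n × Fin (gradeOf B L)) B))
        (MvPolynomial (Fin n × Fin (gradeOf B L)) B) :=
      IsLocalization.self fun x hx ↦ (Submonoid.mem_bot.1 hx) ▸ isUnit_one
    have := hL.succ n f hf (CommRingCat.of (MvPolynomial (Fin n × Fin (gradeOf B L)) B))
      (RingHom.id _) ⊥ (fun s hs h1 ↦ ?_) hloc
    · rwa [Ideal.map_id, RingHom.id_comp] at this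
    · rw [Submonoid.mem_bot.1 hs] at h1
      exact (MvPolynomial.isPrime_map_C (hL.isLinkData hI).isPrime).ne_top
        ((Ideal.eq_top_iff_one _).2 h1)

theorem IsUniversalLinkOf.isLink {R : Type} [CommRing R] [IsLocalRing R]
    {I : Ideal R} {e : ℕ} {B : CommRingCat.{0}} {φ : R →+* B} {L : Ideal B}
    (h : IsUniversalLinkOf R e I B φ L) :
    IsLink R I e B φ L ∧
      ∃ _ : IsLocalRing B, maximalIdeal B = (maximalIdeal R).map φ := by
  induction h with
  | zero => exact ⟨.zero, inferInstance, (Ideal.map_id _).symm⟩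
  | @succ e I B φ L h hB n f hf hQ ih =>
    obtain ⟨hL, hB', hmax⟩ := ih
    have hloc : IsLocalRing (CommRingCat.of (Localization (@Ideal.primeCompl _ _ _ hQ))) :=
      Localization.AtPrime.isLocalRing _
    refine ⟨hL.succ n f hf (CommRingCat.of (Localization (@Ideal.primeCompl _ _ _ hQ)))
      (algebraMap _ (Localization (@Ideal.primeCompl _ _ _ hQ)))
      (@Ideal.primeCompl _ _ _ hQ) (fun s hs ↦ hmax ▸ hs) ?_, hloc, ?_⟩
    · exact IsLocalization.toAlgebra_algebraMap _
    · refine (Localization.AtPrime.map_eq_maximalIdeal (I := (maximalIdeal B).map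
        (MvPolynomial.C (σ := Fin n × Fin (gradeOf B L))))).symm.trans ((congrArg
          (fun K : Ideal B ↦ (K.map (MvPolynomial.C (σ := Fin n × Fin (gradeOf B L)))).map
            (algebraMap _ (Localization (@Ideal.primeCompl _ _ _ hQ)))) hmax).trans ?_)
      rw [Ideal.map_map, Ideal.map_map]
      rfl

theorem IsLink.exists_generators {R : Type} [CommRing R] [IsLocalRing R] [IsNoetherianRing R]
    {I : Ideal R} (hI : ∃ r ∈ I, ¬ IsUnit r ∧ r ∈ nonZeroDivisors R) {e : ℕ}
    {B : CommRingCat.{0}} {φ : R →+* B} {L : Ideal B} (h : IsLink R I e B φ L) :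
    ∃ (n : ℕ) (f : Fin n → B), Ideal.span (Set.range f) = L := by
  have := (h.isLinkData hI).isNoetherianRing
  exact Submodule.fg_iff_exists_fin_generating_family.1 (IsNoetherian.noetherian L)

theorem exists_isGenericLinkOf {R : Type} [CommRing R] [IsLocalRing R] [IsNoetherianRing R]
    {I : Ideal R} (hI : ∃ r ∈ I, ¬ IsUnit r ∧ r ∈ nonZeroDivisors R) (e : ℕ) :
    ∃ (B : CommRingCat.{0}) (φ : R →+* B) (L : Ideal B), IsGenericLinkOf R e I B φ L := by
  induction e with
  | zero => exact ⟨_, _, _, .zero I⟩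
  | succ e ih =>
    obtain ⟨B, φ, L, h⟩ := ih
    obtain ⟨n, f, hf⟩ := (h.isLink hI).exists_generators hI
    exact ⟨_, _, _, h.succ n f hf⟩

theorem exists_isUniversalLinkOf {R : Type} [CommRing R] [IsLocalRing R] [IsNoetherianRing R]
    {I : Ideal R} (hI : ∃ r ∈ I, ¬ IsUnit r ∧ r ∈ nonZeroDivisors R) (e : ℕ) :
    ∃ (B : CommRingCat.{0}) (φ : R →+* B) (L : Ideal B), IsUniversalLinkOf R e I B φ L := by
  induction e with
  | zero => exact ⟨_, _, _, .zero I⟩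
  | succ e ih =>
    obtain ⟨B, φ, L, h⟩ := ih
    obtain ⟨hL, hB, -⟩ := h.isLink
    obtain ⟨n, f, hf⟩ := hL.exists_generators hI
    exact ⟨_, _, _, h.succ hB n f hf
      (MvPolynomial.isPrime_map_C (maximalIdeal.isMaximal B).isPrime)⟩

/-- Lemma 2.2. Let `(R,m,k)` be a Noetherian local Gorenstein ring
with infinite residue field, `I` a Cohen-Macaulay `R`-ideal of positive grade, `C` an
`R`-ideal and `e ≥ 1`. The following are equivalent: some `e`-th generic link of `I` is
contained in `C·R[X]`; every `e`-th generic link of `I` is contained in `C·R[X]`;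
some `e`-th universal link of `I` is contained in `C·R(X)`; every `e`-th universal link
of `I` is contained in `C·R(X)`. -/
theorem statement0 (R : Type) [CommRing R] [IsLocalRing R] [IsNoetherianRing R]
    (hGor : IsGorensteinLocalRing R) (hres : Infinite (IsLocalRing.ResidueField R))
    (I : Ideal R) (hCM : IsCMIdeal R I) (hgrade : ∃ r ∈ I, r ∈ nonZeroDivisors R)
    (C : Ideal R) (e : ℕ) (he : 1 ≤ e) :
    List.TFAE [
      (∃ (B : CommRingCat.{0}) (φ : R →+* B) (L : Ideal B),
        IsGenericLinkOf R e I B φ L ∧ L ≤ C.map φ),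
      (∀ (B : CommRingCat.{0}) (φ : R →+* B) (L : Ideal B),
        IsGenericLinkOf R e I B φ L → L ≤ C.map φ),
      (∃ (B : CommRingCat.{0}) (φ : R →+* B) (L : Ideal B),
        IsUniversalLinkOf R e I B φ L ∧ L ≤ C.map φ),
      (∀ (B : CommRingCat.{0}) (φ : R →+* B) (L : Ideal B),
        IsUniversalLinkOf R e I B φ L → L ≤ C.map φ)] := by
  have hI : ∃ r ∈ I, ¬ IsUnit r ∧ r ∈ nonZeroDivisors R := by
    obtain ⟨hloc, -⟩ := hCM
    obtain ⟨r, hrI, hr⟩ := hgrade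
    exact ⟨r, hrI, fun hu ↦ Ideal.Quotient.nontrivial_iff.1 hloc.toNontrivial
      (Ideal.eq_top_of_isUnit_mem _ hrI hu), hr⟩
  tfae_have 1 → 4 := fun ⟨_, _, _, h, hle⟩ _ _ _ h' ↦
    ((IsLink.isComparable hI (h.isLink hI) h'.isLink.1).le_iff C).1 hle
  tfae_have 4 → 3 := fun h4 ↦ by
    obtain ⟨B, φ, L, h⟩ := exists_isUniversalLinkOf hI e
    exact ⟨B, φ, L, h, h4 B φ L h⟩
  tfae_have 3 → 2 := fun ⟨_, _, _, h, hle⟩ _ _ _ h' ↦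
    ((IsLink.isComparable hI h.isLink.1 (h'.isLink hI)).le_iff C).1 hle
  tfae_have 2 → 1 := fun h2 ↦ by
    obtain ⟨B, φ, L, h⟩ := exists_isGenericLinkOf hI e
    exact ⟨B, φ, L, h, h2 B φ L h⟩
  tfae_finish
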